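/- arXiv:2101.12652 — 2 statements merged into one kernel-verified Lean document; each statement's English description precedes it below -/
import Mathlib

section
/- Let the setting be as in the construction: u₀ ∈ C²([−1−σ,1+σ]) even, with u₀ > 0 on (−1,1), u₀(±1) = 0, u₀ < 0 outside [−1,1], and y·u₀'(y) < 0 for y ≠ 0; ω_i ∈ C¹([−1−σ,1+σ]) positive, even, with ω_i(0) = 1 and y·ω_i'(y) ≤ 0; μ₁ > … > μ_n > 0; α₁ = −1, α₂,…,α_n ∈ ℝ; φ(x,y) = Σ_{j=1}^N Σ_{i=1}^n α_i cosh(√μ_i x_j) ω_i(y); and Ω_ε the connected component of {u₀ + εφ > 0} containing the origin, which for ε small lies in [−M_ε,M_ε]^N × [−1−η,1+η] with M_ε = (1/√μ₁)log(3‖u₀‖_∞/(ε ω₁(1+η))). Then there exist α > 0 and ε₀ > 0 such that for all ε ∈ (0,ε₀) and all boundary points (x,y) ∈ ∂Ω_ε, Σ_{j=1}^N x_j ∂_{x_j}(u₀ + εφ)(x,y) + y ∂_y(u₀ + εφ)(x,y) ≤ −α < 0; consequently Ω_ε is star-shaped with respect to the origin (for every p ∈ Ω_ε and t ∈ (0,1],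 t·p ∈ Ω_ε) and ∂Ω_ε is a smooth hypersurface. -/
open MeasureTheory Set Filter Topology

noncomputable section

/-- Points of `ℝ^{N+1}` written `(x, y)` with `x ∈ ℝ^N`, `y ∈ ℝ`. -/
abbrev Pt (N : ℕ) := (Fin N → ℝ) × ℝ

/-- `φ(x,y) = Σ_j Σ_i α_i cosh(√μ_i x_j) ω_i(y)`. -/
def phi (N n : ℕ) (μ α : Fin n → ℝ) (ω : Fin n → ℝ → ℝ) (p : Pt N) : ℝ :=
  ∑ j : Fin N, ∑ i : Fin n, α i * Real.cosh (Real.sqrt (μ i) * p.1 j) * ω i p.2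

/-- `Ω_ε`: the connected component containing the origin of the set where
`u₀(y) + ε φ(x,y) > 0` (within the strip `ℝ^N × (−1−σ, 1+σ)`). -/
def Ome (N n : ℕ) (σ : ℝ) (u₀ : ℝ → ℝ) (μ α : Fin n → ℝ) (ω : Fin n → ℝ → ℝ) (ε : ℝ) :
    Set (Pt N) :=
  connectedComponentIn
    {p : Pt N | p.2 ∈ Ioo (-1 - σ) (1 + σ) ∧ 0 < u₀ p.2 + ε * phi N n μ α ω p} 0

/-- If `f` is positive at the origin and its radial derivative is negative at every zero in a
star-shaped open set `V`, then `{f > 0} ∩ V` is star-shaped. -/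
lemma starConvex_pos_of_radial_neg {E : Type*} [NormedAddCommGroup E] [NormedSpace ℝ E]
    {V : Set E} (hV : StarConvex ℝ 0 V) {f : E → ℝ}
    (hf : ∀ p ∈ V, DifferentiableAt ℝ f p) (h0 : 0 < f 0)
    (hrad : ∀ p ∈ V, f p = 0 → fderiv ℝ f p p < 0) :
    StarConvex ℝ 0 {p | p ∈ V ∧ 0 < f p} := by
  rw [starConvex_zero_iff]
  rintro p ⟨hpV, hp⟩ s hs0 hs1
  have hmem : ∀ r ∈ Icc (0 : ℝ) 1, r • p ∈ V := fun r hr =>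
    (starConvex_zero_iff.1 hV) hpV hr.1 hr.2
  refine ⟨hmem s ⟨hs0, hs1⟩, ?_⟩
  by_contra! hneg
  have hderiv : ∀ r ∈ Icc (0 : ℝ) 1,
      HasDerivAt (fun r : ℝ => f (r • p)) (fderiv ℝ f (r • p) p) r := fun r hr => by
    have h1 : HasDerivAt (fun r : ℝ => r • p) ((1 : ℝ) • p) r := (hasDerivAt_id r).smul_const p
    rw [one_smul] at h1
    exact (hf _ (hmem r hr)).hasFDerivAt.comp_hasDerivAt r h1
  have hcont : ContinuousOn (fun r : ℝ => f (r • p)) (Icc s 1) := fun r hr =>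
    (hderiv r ⟨hs0.trans hr.1, hr.2⟩).continuousAt.continuousWithinAt
  have hclosed : IsClosed (Icc s 1 ∩ (fun r : ℝ => f (r • p)) ⁻¹' Iic 0) :=
    hcont.preimage_isClosed_of_isClosed isClosed_Icc isClosed_Iic
  have hcompact : IsCompact (Icc s 1 ∩ (fun r : ℝ => f (r • p)) ⁻¹' Iic 0) :=
    isCompact_Icc.of_isClosed_subset hclosed inter_subset_left
  obtain ⟨m, ⟨⟨hm, hmf⟩, hmax⟩⟩ := hcompact.exists_isGreatest ⟨s, ⟨le_rfl, hs1⟩, hneg⟩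
  have hmf' : f (m • p) ≤ 0 := hmf
  have hm1 : m < 1 := by
    refine lt_of_le_of_ne hm.2 ?_
    rintro rfl
    rw [one_smul] at hmf'
    exact absurd hp (not_lt.2 hmf')
  have hpos : ∀ r ∈ Ioc m 1, 0 < f (r • p) := fun r hr => by
    by_contra! h
    exact absurd (hmax ⟨⟨hm.1.trans hr.1.le, hr.2⟩, h⟩) (not_le.2 hr.1)
  have hmI : m ∈ Icc (0 : ℝ) 1 := ⟨hs0.trans hm.1, hm.2⟩
  have hd := hderiv m hmI
  have hev : ∀ᶠ r in 𝓝[>] m, r ∈ Ioc m 1 := Ioc_mem_nhdsGT hm1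
  have hzero : f (m • p) = 0 := by
    refine le_antisymm hmf' ?_
    refine ge_of_tendsto
      (hd.continuousAt.tendsto.mono_left nhdsWithin_le_nhds : Tendsto _ (𝓝[>] m) _) ?_
    exact hev.mono fun r hr => (hpos r hr).le
  have hm0 : 0 < m := by
    refine lt_of_le_of_ne hmI.1 ?_
    rintro rfl
    rw [zero_smul] at hzero
    exact h0.ne' hzero
  have hge : 0 ≤ fderiv ℝ f (m • p) p := by
    have hslope := (hasDerivAt_iff_tendsto_slope.1 hd).mono_left
      (nhdsWithin_mono m (fun r (hr : m < r) => hr.ne') : 𝓝[>] m ≤ 𝓝[≠] m)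
    refine ge_of_tendsto hslope (hev.mono fun r hr => ?_)
    rw [slope_def_field, hzero, sub_zero]
    exact div_nonneg (hpos r hr).le (sub_pos.2 hr.1).le
  have hlt := hrad _ (hmem m hmI) hzero
  rw [map_smul, smul_eq_mul] at hlt
  exact absurd hlt (not_lt.2 (mul_nonneg hm0.le hge))

lemma mul_sinh_nonneg {l : ℝ} (hl : 0 ≤ l) (t : ℝ) : 0 ≤ l * t * Real.sinh (l * t) := by
  rcases le_total 0 t with h | h
  · have : 0 ≤ l * t := mul_nonneg hl h
    exact mul_nonneg this (Real.sinh_nonneg_iff.2 this)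
  · have : l * t ≤ 0 := mul_nonpos_of_nonneg_of_nonpos hl h
    exact mul_nonneg_of_nonpos_of_nonpos this (Real.sinh_nonpos_iff.2 this)

lemma mul_sinh_abs (s : ℝ) : |s| * Real.sinh |s| = s * Real.sinh s := by
  rcases abs_choice s with h | h <;> rw [h]
  rw [Real.sinh_neg]; ring

/-- Hyperbolic functions of lower frequency are negligible, up to an additive constant. -/
lemma exists_cosh_add_mul_sinh_le {l L : ℝ} (hl : 0 ≤ l) (hlL : l < L) {B δ : ℝ} (hB : 0 ≤ B)
    (hδ : 0 < δ) :
    ∃ K, ∀ t, B * (Real.cosh (l * t) + l * t * Real.sinh (l * t)) ≤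
      δ * Real.cosh (L * t) + K := by
  have hlim : Tendsto (fun t : ℝ => B * (1 + l * t) * Real.exp (-((L - l) * t))) atTop (𝓝 0) := by
    have hc : 0 < L - l := sub_pos.2 hlL
    have h0 : Tendsto (fun t : ℝ => Real.exp (-((L - l) * t))) atTop (𝓝 0) :=
      Real.tendsto_exp_neg_atTop_nhds_zero.comp (tendsto_id.const_mul_atTop hc)
    have h1 : Tendsto (fun t : ℝ => ((L - l) * t) * Real.exp (-((L - l) * t))) atTop (𝓝 0) := by
      have := (Real.tendsto_pow_mul_exp_neg_atTop_nhds_zero 1).comp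
        (tendsto_id.const_mul_atTop hc)
      simpa [Function.comp_def] using this
    have h2 := (h0.const_mul B).add (h1.const_mul (B * l / (L - l)))
    simp only [mul_zero, add_zero] at h2
    refine h2.congr fun t => ?_
    field_simp
  obtain ⟨T, hT⟩ := eventually_atTop.1 (hlim.eventually (gt_mem_nhds (half_pos hδ)))
  refine ⟨B * ((1 + l * |T|) * Real.exp (l * |T|)), fun t => ?_⟩
  have hred : ∀ t : ℝ, 0 ≤ t → B * (Real.cosh (l * t) + l * t * Real.sinh (l * t)) ≤
      δ * Real.cosh (L * t) + B * ((1 + l * |T|) * Real.exp (l * |T|)) := by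
    intro t ht
    have hlt : 0 ≤ l * t := mul_nonneg hl ht
    have he : Real.cosh (l * t) + Real.sinh (l * t) = Real.exp (l * t) := Real.cosh_add_sinh _
    have hs : 0 ≤ Real.sinh (l * t) := Real.sinh_nonneg_iff.2 hlt
    have hcp := Real.cosh_pos (l * t)
    have h1 : Real.cosh (l * t) + l * t * Real.sinh (l * t) ≤
        (1 + l * t) * Real.exp (l * t) := by
      rw [← he]; nlinarith [mul_nonneg hlt hcp.le]
    refine (mul_le_mul_of_nonneg_left h1 hB).trans ?_
    rcases le_total t |T| with h | h
    · have h2 : (1 + l * t) * Real.exp (l * t) ≤ (1 + l * |T|) * Real.exp (l * |T|) := by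
        gcongr
      have := mul_le_mul_of_nonneg_left h2 hB
      have := mul_pos hδ (Real.cosh_pos (L * t))
      linarith
    · have h2 := hT t ((le_abs_self T).trans h)
      have h3 : Real.exp (-((L - l) * t)) * Real.exp (L * t) = Real.exp (l * t) := by
        rw [← Real.exp_add]; ring_nf
      have h4 : B * ((1 + l * t) * Real.exp (l * t)) ≤ δ / 2 * Real.exp (L * t) := by
        rw [← h3]
        calc _ = B * (1 + l * t) * Real.exp (-((L - l) * t)) * Real.exp (L * t) := by ring
          _ ≤ _ := mul_le_mul_of_nonneg_right h2.le (Real.exp_pos _).le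
      have h5 : Real.exp (L * t) ≤ 2 * Real.cosh (L * t) := by
        rw [Real.cosh_eq]; linarith [Real.exp_pos (-(L * t))]
      have h6 : 0 ≤ B * ((1 + l * |T|) * Real.exp (l * |T|)) := by positivity
      nlinarith
  have h := hred |t| (abs_nonneg t)
  have e : ∀ {k : ℝ}, 0 ≤ k → k * |t| = |k * t| := fun hk => by rw [abs_mul, abs_of_nonneg hk]
  rw [e hl, e (hl.trans hlL.le), Real.cosh_abs, Real.cosh_abs, mul_sinh_abs] at h
  exact h

lemma exists_cosh_le_mul_sinh {B δ : ℝ} (hB : 0 ≤ B) (hδ : 0 < δ) :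
    ∃ K, ∀ s, B * Real.cosh s ≤ δ * (s * Real.sinh s) + K := by
  refine ⟨B * Real.cosh (B / δ) + B, fun s => ?_⟩
  rw [← Real.cosh_abs s, ← mul_sinh_abs s]
  have hs : 0 ≤ Real.sinh |s| := Real.sinh_nonneg_iff.2 (abs_nonneg s)
  rcases le_total |s| (B / δ) with h | h
  · have h1 : Real.cosh |s| ≤ Real.cosh (B / δ) := by
      rw [Real.cosh_le_cosh, abs_abs, abs_of_nonneg (div_nonneg hB hδ.le)]; exact h
    have h2 := mul_le_mul_of_nonneg_left h1 hB
    have h3 : 0 ≤ δ * (|s| * Real.sinh |s|) := by positivity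
    linarith
  · have h1 : B ≤ δ * |s| := by rw [div_le_iff₀ hδ] at h; linarith
    have h2 : Real.cosh |s| ≤ Real.sinh |s| + 1 := by
      have h4 := Real.cosh_sub_sinh |s|
      have h5 : Real.exp (-|s|) ≤ 1 := Real.exp_le_one_iff.2 (neg_nonpos.2 (abs_nonneg s))
      linarith
    have h3 := mul_le_mul_of_nonneg_left h2 hB
    have h4 := mul_le_mul_of_nonneg_right h1 hs
    have h5 : 0 ≤ B * Real.cosh (B / δ) := mul_nonneg hB (Real.cosh_pos _).le
    linarith

/-- A finite sum is dominated by its leading term if all the others are negligible. -/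
lemma exists_sum_le_of_dominant {n : ℕ} {X : Type*} (S : Set X) (T : Fin n → X → ℝ) (C : X → ℝ)
    (hC : ∀ p, 0 ≤ C p) (i₀ : Fin n) {c : ℝ} (hc : 0 < c)
    (h₀ : ∃ K, ∀ p ∈ S, T i₀ p ≤ K - c * C p)
    (h : ∀ i, i ≠ i₀ → ∀ δ > 0, ∃ K, ∀ p ∈ S, T i p ≤ δ * C p + K) :
    ∃ K, ∀ p ∈ S, ∑ i, T i p ≤ K - c / 2 * C p := by
  have hn : (0 : ℝ) < n := by exact_mod_cast i₀.pos
  have hδ : 0 < c / (2 * n) := by positivity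
  have key : ∀ i, ∃ K, ∀ p ∈ S, T i p ≤
      K + c / (2 * n) * C p - (if i = i₀ then c * C p else 0) := by
    intro i
    by_cases hi : i = i₀
    · subst hi
      obtain ⟨K, hK⟩ := h₀
      refine ⟨K, fun p hp => ?_⟩
      rw [if_pos rfl]
      linarith [hK p hp, mul_nonneg hδ.le (hC p)]
    · obtain ⟨K, hK⟩ := h i hi _ hδ
      exact ⟨K, fun p hp => by rw [if_neg hi]; linarith [hK p hp]⟩
  choose K hK using key
  refine ⟨∑ i, K i, fun p hp => (Finset.sum_le_sum fun i _ => hK i p hp).trans_eq ?_⟩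
  rw [Finset.sum_sub_distrib, Finset.sum_add_distrib, Finset.sum_ite_eq' Finset.univ i₀]
  simp only [Finset.mem_univ, if_true, Finset.sum_const, Finset.card_univ, Fintype.card_fin,
    nsmul_eq_mul]
  field_simp
  ring

lemma exists_abs_mul_deriv_le {a b : ℝ} (hab : a < b) {f : ℝ → ℝ}
    (hf : ContDiffOn ℝ 1 f (Icc a b)) :
    ∃ D, ∀ y ∈ Ioo a b, |y * deriv f y| ≤ D := by
  obtain ⟨D, hD⟩ := isCompact_Icc.exists_bound_of_continuousOn
    (continuousOn_id.mul (hf.continuousOn_derivWithin (uniqueDiffOn_Icc hab) le_rfl))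
  refine ⟨D, fun y hy => ?_⟩
  have := hD y (Ioo_subset_Icc_self hy)
  rwa [Pi.mul_apply, derivWithin_of_mem_nhds (Icc_mem_nhds hy.1 hy.2)] at this

lemma exists_mul_deriv_le_neg {a b : ℝ} (hab : a < b) {f : ℝ → ℝ}
    (hf : ContDiffOn ℝ 1 f (Icc a b)) (hrad : ∀ y ∈ Icc a b, y ≠ 0 → y * deriv f y < 0)
    {δ : ℝ} (hδ : 0 < δ) :
    ∃ c > 0, ∀ y ∈ Icc a b, δ ≤ |y| → y * deriv f y ≤ -c := by
  have hne : ∀ y, δ ≤ |y| → y ≠ 0 := fun y hy h => by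
    rw [h, abs_zero] at hy; exact absurd hδ (not_lt.2 hy)
  have heq : ∀ y ∈ Icc a b, δ ≤ |y| → derivWithin f (Icc a b) y = deriv f y := by
    intro y hy hyδ
    refine DifferentiableAt.derivWithin ?_ (uniqueDiffOn_Icc hab y hy)
    by_contra hnd
    have := hrad y hy (hne y hyδ)
    rw [deriv_zero_of_not_differentiableAt hnd, mul_zero] at this
    exact lt_irrefl _ this
  have hcomp : IsCompact (Icc a b ∩ {y | δ ≤ |y|}) :=
    isCompact_Icc.inter_right (isClosed_le continuous_const continuous_abs)
  have hcont : ContinuousOn (fun y => y * derivWithin f (Icc a b) y) (Icc a b ∩ {y | δ ≤ |y|}) :=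
    (continuousOn_id.mul (hf.continuousOn_derivWithin (uniqueDiffOn_Icc hab) le_rfl)).mono
      inter_subset_left
  rcases (Icc a b ∩ {y | δ ≤ |y|}).eq_empty_or_nonempty with he | hne'
  · exact ⟨1, one_pos, fun y hy hyδ => absurd (he.subset ⟨hy, hyδ⟩) (notMem_empty y)⟩
  · obtain ⟨z, ⟨hz, hzδ⟩, hmax⟩ := hcomp.exists_isMaxOn hne' hcont
    refine ⟨-(z * deriv f z), neg_pos.2 (hrad z hz (hne z hzδ)), fun y hy hyδ => ?_⟩
    have : y * derivWithin f (Icc a b) y ≤ z * derivWithin f (Icc a b) z := hmax ⟨hy, hyδ⟩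
    rw [heq y hy hyδ, heq z hz hzδ] at this
    linarith

section Profile

variable {n : ℕ} {a b : ℝ} {μ α : Fin n → ℝ} {ω : Fin n → ℝ → ℝ} {i₀ : Fin n}

/-- The one-variable profile is bounded above when its leading coefficient is `-1`. -/
lemma exists_sum_cosh_le (hμ : ∀ i, i ≠ i₀ → √(μ i) < √(μ i₀)) (hα : α i₀ = -1)
    (hab : a ≤ b) (hω : ∀ i, ContinuousOn (ω i) (Icc a b)) (hpos : ∀ i, ∀ y ∈ Icc a b, 0 < ω i y) :
    ∃ K, ∀ t : ℝ, ∀ y ∈ Icc a b, ∑ i, α i * Real.cosh (√(μ i) * t) * ω i y ≤ K := by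
  obtain ⟨z, hz, hmin⟩ := isCompact_Icc.exists_isMinOn (nonempty_Icc.2 hab) (hω i₀)
  have hw := hpos i₀ z hz
  obtain ⟨K, hK⟩ := exists_sum_le_of_dominant {p : ℝ × ℝ | p.2 ∈ Icc a b}
    (fun i p => α i * Real.cosh (√(μ i) * p.1) * ω i p.2) (fun p => Real.cosh (√(μ i₀) * p.1))
    (fun p => (Real.cosh_pos _).le) i₀ hw ⟨0, fun p hp => by
      have h1 : ω i₀ z ≤ ω i₀ p.2 := hmin hp
      have := mul_le_mul_of_nonneg_right h1 (Real.cosh_pos (√(μ i₀) * p.1)).le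
      rw [hα]; linarith⟩ (fun i hi δ hδ => by
      obtain ⟨W, hW⟩ := isCompact_Icc.exists_bound_of_continuousOn (hω i)
      have hW0 : 0 ≤ W := (norm_nonneg _).trans (hW z hz)
      obtain ⟨K, hK⟩ := exists_cosh_add_mul_sinh_le (Real.sqrt_nonneg _) (hμ i hi)
        (mul_nonneg (abs_nonneg (α i)) hW0) hδ
      refine ⟨K, fun p hp => le_trans ?_ (hK p.1)⟩
      have hs := mul_sinh_nonneg (Real.sqrt_nonneg (μ i)) p.1
      calc α i * Real.cosh (√(μ i) * p.1) * ω i p.2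
          ≤ |α i * Real.cosh (√(μ i) * p.1) * ω i p.2| := le_abs_self _
        _ = |α i| * |ω i p.2| * Real.cosh (√(μ i) * p.1) := by
          rw [abs_mul, abs_mul, abs_of_pos (Real.cosh_pos _)]; ring
        _ ≤ |α i| * W * (Real.cosh (√(μ i) * p.1) +
              √(μ i) * p.1 * Real.sinh (√(μ i) * p.1)) := by
          have := hW _ hp
          rw [Real.norm_eq_abs] at this
          have hc := (Real.cosh_pos (√(μ i) * p.1)).le
          gcongr
          linarith)
  refine ⟨K, fun t y hy => (hK (t, y) hy).trans ?_⟩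
  have := mul_pos (half_pos hw) (Real.cosh_pos (√(μ i₀) * t))
  linarith

/-- The radial derivative of the one-variable profile tends to `-∞` at least as fast as the
leading hyperbolic cosine. -/
lemma exists_sum_radial_le (hμ : ∀ i, i ≠ i₀ → √(μ i) < √(μ i₀)) (hα : α i₀ = -1)
    (hab : a < b) (hω : ∀ i, ContDiffOn ℝ 1 (ω i) (Icc a b))
    (hpos : ∀ i, ∀ y ∈ Icc a b, 0 < ω i y) :
    ∃ K, ∀ t : ℝ, ∀ y ∈ Ioo a b,
      ∑ i, α i * (√(μ i) * t * Real.sinh (√(μ i) * t) * ω i y +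
        Real.cosh (√(μ i) * t) * (y * deriv (ω i) y)) ≤
      K - 1 / 2 * Real.cosh (√(μ i₀) * t) := by
  obtain ⟨z, hz, hmin⟩ := isCompact_Icc.exists_isMinOn (nonempty_Icc.2 hab.le)
    (hω i₀).continuousOn
  have hw := hpos i₀ z hz
  obtain ⟨x, hx⟩ := nonempty_Ioo.2 hab
  obtain ⟨K, hK⟩ := exists_sum_le_of_dominant {p : ℝ × ℝ | p.2 ∈ Ioo a b}
    (fun i p => α i * (√(μ i) * p.1 * Real.sinh (√(μ i) * p.1) * ω i p.2 +
        Real.cosh (√(μ i) * p.1) * (p.2 * deriv (ω i) p.2)))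
    (fun p => Real.cosh (√(μ i₀) * p.1))
    (fun p => (Real.cosh_pos _).le) i₀ one_pos (by
      obtain ⟨D, hD⟩ := exists_abs_mul_deriv_le hab (hω i₀)
      have hD0 : 0 ≤ D := (abs_nonneg _).trans (hD x hx)
      obtain ⟨K, hK⟩ := exists_cosh_le_mul_sinh (add_nonneg hD0 zero_le_one) hw
      refine ⟨K, fun p hp => ?_⟩
      have h1 : ω i₀ z ≤ ω i₀ p.2 := hmin (Ioo_subset_Icc_self hp)
      have h2 := mul_le_mul_of_nonneg_right h1
        (mul_sinh_nonneg (Real.sqrt_nonneg (μ i₀)) p.1)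
      have h3 := mul_le_mul_of_nonneg_right (neg_le_of_abs_le (hD _ hp))
        (Real.cosh_pos (√(μ i₀) * p.1)).le
      have h4 := hK (√(μ i₀) * p.1)
      rw [hα]
      linarith) (fun i hi δ hδ => by
      obtain ⟨W, hW⟩ := isCompact_Icc.exists_bound_of_continuousOn (hω i).continuousOn
      obtain ⟨D, hD⟩ := exists_abs_mul_deriv_le hab (hω i)
      have hW0 : 0 ≤ W := (norm_nonneg _).trans (hW z hz)
      have hD0 : 0 ≤ D := (abs_nonneg _).trans (hD x hx)
      obtain ⟨K, hK⟩ := exists_cosh_add_mul_sinh_le (Real.sqrt_nonneg _) (hμ i hi)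
        (mul_nonneg (abs_nonneg (α i)) (add_nonneg hW0 hD0)) hδ
      refine ⟨K, fun p hp => le_trans ?_ (hK p.1)⟩
      have hs := mul_sinh_nonneg (Real.sqrt_nonneg (μ i)) p.1
      have hc := (Real.cosh_pos (√(μ i) * p.1)).le
      have hWp := hW _ (Ioo_subset_Icc_self hp)
      rw [Real.norm_eq_abs] at hWp
      refine (le_abs_self _).trans ?_
      rw [abs_mul, mul_assoc |α i|]
      refine mul_le_mul_of_nonneg_left ((abs_add_le _ _).trans ?_) (abs_nonneg (α i))
      rw [abs_mul, abs_mul (Real.cosh _), abs_of_nonneg hs, abs_of_pos (Real.cosh_pos _)]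
      have h1 := mul_le_mul_of_nonneg_left hWp hs
      have h2 := mul_le_mul_of_nonneg_left (hD _ hp) hc
      have h3 := mul_nonneg hD0 hs
      have h4 := mul_nonneg hW0 hc
      linarith)
  exact ⟨K, fun t y hy => hK (t, y) hy⟩

lemma exists_neg_mul_cosh_le_sum (hμ : ∀ i, √(μ i) ≤ √(μ i₀)) (hab : a ≤ b)
    (hω : ∀ i, ContinuousOn (ω i) (Icc a b)) :
    ∃ C > 0, ∀ t : ℝ, ∀ y ∈ Icc a b,
      -(C * Real.cosh (√(μ i₀) * t)) ≤ ∑ i, α i * Real.cosh (√(μ i) * t) * ω i y := by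
  have hex : ∀ i, ∃ W, ∀ y ∈ Icc a b, ‖ω i y‖ ≤ W := fun i =>
    isCompact_Icc.exists_bound_of_continuousOn (hω i)
  choose W hW using hex
  have hW0 : ∀ i, 0 ≤ W i := fun i => (norm_nonneg _).trans (hW i a (left_mem_Icc.2 hab))
  have hsum : 0 ≤ ∑ i, |α i| * W i :=
    Finset.sum_nonneg fun i _ => mul_nonneg (abs_nonneg _) (hW0 i)
  refine ⟨∑ i, |α i| * W i + 1, by linarith, fun t y hy => ?_⟩
  have hc := Real.cosh_pos (√(μ i₀) * t)
  refine neg_le_of_neg_le ((neg_le_abs _).trans ((Finset.abs_sum_le_sum_abs _ _).trans ?_))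
  calc ∑ i, |α i * Real.cosh (√(μ i) * t) * ω i y|
      ≤ ∑ i, |α i| * W i * Real.cosh (√(μ i₀) * t) := by
        refine Finset.sum_le_sum fun i _ => ?_
        have hle : Real.cosh (√(μ i) * t) ≤ Real.cosh (√(μ i₀) * t) := by
          rw [Real.cosh_le_cosh, abs_mul, abs_mul, abs_of_nonneg (Real.sqrt_nonneg _),
            abs_of_nonneg (Real.sqrt_nonneg _)]
          exact mul_le_mul_of_nonneg_right (hμ i) (abs_nonneg t)
        have h2 := hW i y hy
        rw [Real.norm_eq_abs] at h2
        rw [abs_mul, abs_mul, abs_of_pos (Real.cosh_pos _)]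
        calc |α i| * Real.cosh (√(μ i) * t) * |ω i y|
            ≤ |α i| * Real.cosh (√(μ i₀) * t) * W i := by gcongr
          _ = _ := by ring
    _ = (∑ i, |α i| * W i) * Real.cosh (√(μ i₀) * t) := by rw [Finset.sum_mul]
    _ ≤ _ := by nlinarith

end Profile

section Perturbation

variable {N n : ℕ} {u₀ : ℝ → ℝ} {μ α : Fin n → ℝ} {ω : Fin n → ℝ → ℝ} {ε : ℝ} {p : Pt N}

lemma sum_mul_fderiv_eq_radial (f : Pt N → ℝ) (p : Pt N) :
    (∑ j, p.1 j * fderiv ℝ f p (Pi.single j 1, 0)) + p.2 * fderiv ℝ f p (0, 1) =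
      fderiv ℝ f p p := by
  have hp : p = ∑ j, p.1 j • ((Pi.single j 1, 0) : Pt N) + p.2 • ((0, 1) : Pt N) := by
    refine Prod.ext ?_ ?_
    · ext k
      simp [Prod.fst_sum, Finset.sum_apply, Pi.single_apply]
    · simp [Prod.snd_sum]
  conv_rhs => arg 2; rw [hp]
  simp only [map_add, map_sum, map_smul, smul_eq_mul]

lemma contDiffAt_add_mul_phi (hu : ContDiffAt ℝ 1 u₀ p.2) (hω : ∀ i, ContDiffAt ℝ 1 (ω i) p.2) :
    ContDiffAt ℝ 1 (fun q : Pt N => u₀ q.2 + ε * phi N n μ α ω q) p := by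
  refine (hu.comp p contDiffAt_snd).add (contDiffAt_const.mul ?_)
  refine ContDiffAt.sum fun j _ => ContDiffAt.sum fun i _ => ?_
  refine (contDiffAt_const.mul ?_).mul ((hω i).comp p contDiffAt_snd)
  refine Real.contDiff_cosh.contDiffAt.comp p (contDiffAt_const.mul ?_)
  exact ((contDiff_apply ℝ ℝ j).contDiffAt).comp p contDiffAt_fst

lemma fderiv_radial_eq (hu : ContDiffAt ℝ 1 u₀ p.2) (hω : ∀ i, ContDiffAt ℝ 1 (ω i) p.2) :
    fderiv ℝ (fun q : Pt N => u₀ q.2 + ε * phi N n μ α ω q) p p =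
      p.2 * deriv u₀ p.2 + ε * ∑ j, ∑ i, α i *
        (√(μ i) * p.1 j * Real.sinh (√(μ i) * p.1 j) * ω i p.2 +
          Real.cosh (√(μ i) * p.1 j) * (p.2 * deriv (ω i) p.2)) := by
  have hline : HasDerivAt (fun s : ℝ => s • p) p 1 := by
    simpa using (hasDerivAt_id (1 : ℝ)).smul_const p
  have hf : DifferentiableAt ℝ (fun q : Pt N => u₀ q.2 + ε * phi N n μ α ω q) ((1 : ℝ) • p) := by
    rw [one_smul]
    exact (contDiffAt_add_mul_phi hu hω).differentiableAt one_ne_zero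
  have h1 := hf.hasFDerivAt.comp_hasDerivAt (1 : ℝ) hline
  rw [one_smul] at h1
  have hy : HasDerivAt (fun s : ℝ => s * p.2) p.2 1 := by
    simpa using (hasDerivAt_id (1 : ℝ)).mul_const p.2
  have hcomp : ∀ g : ℝ → ℝ, ContDiffAt ℝ 1 g p.2 →
      HasDerivAt (fun s : ℝ => g (s * p.2)) (p.2 * deriv g p.2) 1 := by
    intro g hg
    have hg' : HasDerivAt g (deriv g p.2) (1 * p.2) := by
      rw [one_mul]; exact (hg.differentiableAt one_ne_zero).hasDerivAt
    have := hg'.comp (1 : ℝ) hy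
    rwa [mul_comm] at this
  have hcosh : ∀ i j, HasDerivAt (fun s : ℝ => Real.cosh (√(μ i) * (s * p.1 j)))
      (Real.sinh (√(μ i) * p.1 j) * (√(μ i) * p.1 j)) 1 := by
    intro i j
    have h : HasDerivAt (fun s : ℝ => √(μ i) * (s * p.1 j)) (√(μ i) * p.1 j) 1 := by
      simpa using ((hasDerivAt_id (1 : ℝ)).mul_const (p.1 j)).const_mul (√(μ i))
    simpa using h.cosh
  have h2 : HasDerivAt (fun s : ℝ => u₀ (s * p.2) + ε * ∑ j, ∑ i, α i *
        Real.cosh (√(μ i) * (s * p.1 j)) * ω i (s * p.2)) _ 1 :=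
    (hcomp u₀ hu).add ((HasDerivAt.fun_sum fun j _ => HasDerivAt.fun_sum fun i _ =>
      ((hcosh i j).const_mul (α i)).mul (hcomp (ω i) (hω i))).const_mul ε)
  refine (h1.unique h2).trans ?_
  simp only [one_mul]
  congr 2
  refine Finset.sum_congr rfl fun j _ => Finset.sum_congr rfl fun i _ => ?_
  ring

end Perturbation

theorem statement5 (N : ℕ) (hN : 1 ≤ N) (σ : ℝ) (hσ : 0 < σ)
    (u₀ : ℝ → ℝ) (hu₀C : ContDiffOn ℝ 2 u₀ (Icc (-1 - σ) (1 + σ)))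
    (hu₀even : ∀ y, u₀ (-y) = u₀ y)
    (hu₀pos : ∀ y ∈ Ioo (-1:ℝ) 1, 0 < u₀ y)
    (hu₀1 : u₀ 1 = 0) (hu₀m1 : u₀ (-1) = 0)
    (hu₀neg : ∀ y ∈ Ico (-1 - σ) (-1) ∪ Ioc 1 (1 + σ), u₀ y < 0)
    -- y·u₀'(y) < 0 for y ≠ 0
    (hu₀rad : ∀ y ∈ Icc (-1 - σ) (1 + σ), y ≠ 0 → y * deriv u₀ y < 0)
    (n : ℕ) (hn : 0 < n)
    (μ : Fin n → ℝ) (hμanti : StrictAnti μ) (hμpos : ∀ i, 0 < μ i)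
    (α : Fin n → ℝ) (hα1 : α ⟨0, hn⟩ = -1)
    (ω : Fin n → ℝ → ℝ)
    (hωC1 : ∀ i, ContDiffOn ℝ 1 (ω i) (Icc (-1 - σ) (1 + σ)))
    (hωpos : ∀ i, ∀ y ∈ Icc (-1 - σ) (1 + σ), 0 < ω i y)
    (hωeven : ∀ i y, ω i (-y) = ω i y)
    (hω0 : ∀ i, ω i 0 = 1)
    (hωrad : ∀ i, ∀ y ∈ Icc (-1 - σ) (1 + σ), y * deriv (ω i) y ≤ 0) :
    ∃ a > (0:ℝ), ∃ ε₀ > (0:ℝ), ∀ ε ∈ Ioo (0:ℝ) ε₀,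
      -- the radial derivative of u₀ + εφ is ≤ −a < 0 on ∂Ω_ε
      (∀ p ∈ frontier (Ome N n σ u₀ μ α ω ε),
        (∑ j, p.1 j *
            fderiv ℝ (fun q : Pt N => u₀ q.2 + ε * phi N n μ α ω q) p (Pi.single j 1, 0)) +
          p.2 * fderiv ℝ (fun q : Pt N => u₀ q.2 + ε * phi N n μ α ω q) p (0, 1) ≤ -a) ∧
      -- consequently Ω_ε is star-shaped with respect to the origin
      (∀ p ∈ Ome N n σ u₀ μ α ω ε, ∀ s ∈ Ioc (0:ℝ) 1, s • p ∈ Ome N n σ u₀ μ α ω ε) ∧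
      -- and ∂Ω_ε is a smooth hypersurface: locally a regular level set
      (∀ p ∈ frontier (Ome N n σ u₀ μ α ω ε), ∃ F : Pt N → ℝ,
        ContDiffAt ℝ 1 F p ∧ fderiv ℝ F p ≠ 0 ∧
        ∀ᶠ q in nhds p, (q ∈ Ome N n σ u₀ μ α ω ε ↔ F q < 0)) := by
  set i₀ : Fin n := ⟨0, hn⟩
  have hab : -1 - σ < 1 + σ := by linarith
  have hsqrt : ∀ i, i ≠ i₀ → √(μ i) < √(μ i₀) := fun i hi =>
    Real.sqrt_lt_sqrt (hμpos i).le (hμanti (lt_of_le_of_ne (Nat.zero_le _) hi.symm))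
  have hsqrt' : ∀ i, √(μ i) ≤ √(μ i₀) := fun i => by
    by_cases hi : i = i₀
    · rw [hi]
    · exact (hsqrt i hi).le
  have hωc : ∀ i, ContinuousOn (ω i) (Icc (-1 - σ) (1 + σ)) := fun i => (hωC1 i).continuousOn
  have hu₀C1 : ContDiffOn ℝ 1 u₀ (Icc (-1 - σ) (1 + σ)) := hu₀C.of_le (by norm_num)
  obtain ⟨K, hK⟩ := exists_sum_cosh_le hsqrt hα1 hab.le hωc hωpos
  obtain ⟨K', hK'⟩ := exists_sum_radial_le hsqrt hα1 hab hωC1 hωpos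
  obtain ⟨C, hC, hCle⟩ := exists_neg_mul_cosh_le_sum (α := α) hsqrt' hab.le hωc
  have hu00 : 0 < u₀ 0 := hu₀pos 0 (by norm_num)
  have hend : u₀ (1 + σ) < 0 := hu₀neg _ (Or.inr ⟨by linarith, le_rfl⟩)
  have h0I : Icc (-1 - σ) (1 + σ) ∈ 𝓝 (0 : ℝ) := Icc_mem_nhds (by linarith) (by linarith)
  obtain ⟨δ, hδ, hδu⟩ : ∃ δ > 0, ∀ y : ℝ, |y| < δ → u₀ 0 / 2 < u₀ y := by
    have := (hu₀C.continuousOn.continuousAt h0I).eventually (lt_mem_nhds (half_lt_self hu00))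
    obtain ⟨δ, hδ, h⟩ := Metric.eventually_nhds_iff.1 this
    exact ⟨δ, hδ, fun y hy => h (by rwa [Real.dist_eq, sub_zero])⟩
  obtain ⟨c, hc, hcu⟩ := exists_mul_deriv_le_neg hab hu₀C1 hu₀rad hδ
  have hsmall : ∀ X Y : ℝ, 0 < Y → ∀ᶠ ε in 𝓝[>] (0 : ℝ), ε * X < Y := fun X Y hY => by
    have : Tendsto (fun ε : ℝ => ε * X) (𝓝[>] 0) (𝓝 (0 * X)) :=
      (tendsto_id.mul_const X).mono_left nhdsWithin_le_nhds
    rw [zero_mul] at this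
    exact this.eventually (gt_mem_nhds hY)
  have hd : 0 < u₀ 0 / (8 * C) := by positivity
  have hevent := (hsmall (N * K) _ (neg_pos.2 hend)).and ((hsmall (-phi N n μ α ω 0) _ hu00).and
    ((hsmall (N * K') _ (half_pos hc)).and (hsmall (N * K') _ hd)))
  obtain ⟨ε₀, hε₀, hsub⟩ := mem_nhdsGT_iff_exists_Ioo_subset.1 hevent
  refine ⟨min (c / 2) (u₀ 0 / (8 * C)), lt_min (half_pos hc) hd, ε₀, hε₀, fun ε hε => ?_⟩
  obtain ⟨hε1, hε2, hε3, hε4⟩ := hsub hε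
  have hεpos : 0 < ε := hε.1
  set f : Pt N → ℝ := fun q => u₀ q.2 + ε * phi N n μ α ω q with hf
  set V : Set (Pt N) := {p | p.2 ∈ Ioo (-1 - σ) (1 + σ)} with hV
  have hVopen : IsOpen V := isOpen_Ioo.preimage continuous_snd
  have hVstar : StarConvex ℝ 0 V := by
    have hconv : Convex ℝ V := (convex_Ioo (-1 - σ) (1 + σ)).linear_preimage (LinearMap.snd ℝ _ ℝ)
    exact hconv.starConvex ⟨by simp; linarith, by simp; linarith⟩
  have hC1 : ∀ {g : ℝ → ℝ}, ContDiffOn ℝ 1 g (Icc (-1 - σ) (1 + σ)) → ∀ p ∈ V,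
      ContDiffAt ℝ 1 g p.2 := fun hg p hp => hg.contDiffAt (Icc_mem_nhds hp.1 hp.2)
  have hfC1 : ∀ p ∈ V, ContDiffAt ℝ 1 f p := fun p hp =>
    contDiffAt_add_mul_phi (hC1 hu₀C1 p hp) fun i => hC1 (hωC1 i) p hp
  have hf0 : 0 < f 0 := by
    simp only [hf, Prod.snd_zero]
    linarith
  have hfrad : ∀ p ∈ V, f p = 0 → fderiv ℝ f p p ≤ -min (c / 2) (u₀ 0 / (8 * C)) := by
    intro p hp hfp
    have hpI : p.2 ∈ Icc (-1 - σ) (1 + σ) := Ioo_subset_Icc_self hp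
    rw [hf, fderiv_radial_eq (hC1 hu₀C1 p hp) fun i => hC1 (hωC1 i) p hp]
    have h1 := mul_le_mul_of_nonneg_left
      (Finset.sum_le_sum fun (j : Fin N) (_ : j ∈ Finset.univ) => hK' (p.1 j) p.2 hp) hεpos.le
    rw [Finset.sum_sub_distrib, ← Finset.mul_sum, Finset.sum_const, Finset.card_univ,
      Fintype.card_fin, nsmul_eq_mul] at h1
    have hS : 0 ≤ ∑ j, Real.cosh (√(μ i₀) * p.1 j) :=
      Finset.sum_nonneg fun j _ => (Real.cosh_pos _).le
    have hεS := mul_nonneg hεpos.le hS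
    rcases lt_or_ge |p.2| δ with hy | hy
    · have h2 := mul_le_mul_of_nonneg_left
        (Finset.sum_le_sum fun (j : Fin N) (_ : j ∈ Finset.univ) => hCle (p.1 j) p.2 hpI) hεpos.le
      rw [Finset.sum_neg_distrib, ← Finset.mul_sum] at h2
      have h3 : u₀ p.2 + ε * ∑ j, ∑ i, α i * Real.cosh (√(μ i) * p.1 j) * ω i p.2 = 0 := hfp
      have h4 := hδu _ hy
      have h5 : p.2 * deriv u₀ p.2 ≤ 0 := by
        by_cases h : p.2 = 0
        · rw [h, zero_mul]
        · exact (hu₀rad _ hpI h).le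
      have h6 : u₀ 0 / 2 / C ≤ ε * ∑ j, Real.cosh (√(μ i₀) * p.1 j) := by
        rw [div_le_iff₀ hC]; linarith
      have h7 : u₀ 0 / 2 / C = 4 * (u₀ 0 / (8 * C)) := by field_simp; norm_num
      have h8 := min_le_right (c / 2) (u₀ 0 / (8 * C))
      linarith
    · have h2 := hcu _ hpI hy
      have h3 := min_le_left (c / 2) (u₀ 0 / (8 * C))
      linarith
  have hmin : 0 < min (c / 2) (u₀ 0 / (8 * C)) := lt_min (half_pos hc) hd
  have hstar : StarConvex ℝ 0 {p | p ∈ V ∧ 0 < f p} :=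
    starConvex_pos_of_radial_neg hVstar (fun p hp => (hfC1 p hp).differentiableAt one_ne_zero) hf0
      fun p hp hfp => (hfrad p hp hfp).trans_lt (neg_lt_zero.2 hmin)
  have h0U : (0 : Pt N) ∈ {p | p ∈ V ∧ 0 < f p} :=
    ⟨⟨by simp; linarith, by simp; linarith⟩, hf0⟩
  have hOme : Ome N n σ u₀ μ α ω ε = {p | p ∈ V ∧ 0 < f p} :=
    (hstar.isPathConnected h0U).isConnected.isPreconnected.connectedComponentIn h0U
  have hUopen : IsOpen {p | p ∈ V ∧ 0 < f p} :=
    ContinuousOn.isOpen_inter_preimage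
      (fun p hp => (hfC1 p hp).continuousAt.continuousWithinAt) hVopen isOpen_Ioi
  have hfront : ∀ p ∈ frontier {p | p ∈ V ∧ 0 < f p}, p ∈ V ∧ f p = 0 := by
    intro p hp
    have hstrip : IsClosed {p : Pt N | p.2 ∈ Icc (-1 - σ) (1 + σ)} :=
      isClosed_Icc.preimage continuous_snd
    have hfcont : ContinuousOn f {p : Pt N | p.2 ∈ Icc (-1 - σ) (1 + σ)} := by
      have hsnd : ∀ {g : ℝ → ℝ}, ContinuousOn g (Icc (-1 - σ) (1 + σ)) →
          ContinuousOn (fun p : Pt N => g p.2) {p : Pt N | p.2 ∈ Icc (-1 - σ) (1 + σ)} :=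
        fun hg => hg.comp continuousOn_snd fun p hp => hp
      refine (hsnd hu₀C.continuousOn).add (continuousOn_const.mul ?_)
      refine continuousOn_finsetSum _ fun j _ => continuousOn_finsetSum _ fun i _ => ?_
      refine ContinuousOn.mul (Continuous.continuousOn ?_) (hsnd (hωc i))
      fun_prop
    have hclosed := hfcont.preimage_isClosed_of_isClosed hstrip (isClosed_Ici (a := (0 : ℝ)))
    have hsubset : {p | p ∈ V ∧ 0 < f p} ⊆
        {p : Pt N | p.2 ∈ Icc (-1 - σ) (1 + σ)} ∩ f ⁻¹' Ici 0 :=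
      fun q hq => ⟨Ioo_subset_Icc_self hq.1, hq.2.le⟩
    obtain ⟨hpI, hfp⟩ := closure_minimal hsubset hclosed (frontier_subset_closure hp)
    have hpI' : p.2 ∈ Icc (-1 - σ) (1 + σ) := hpI
    have hfp' : 0 ≤ u₀ p.2 + ε * ∑ j, ∑ i, α i * Real.cosh (√(μ i) * p.1 j) * ω i p.2 := hfp
    have h1 := mul_le_mul_of_nonneg_left
      (Finset.sum_le_sum fun (j : Fin N) (_ : j ∈ Finset.univ) => hK (p.1 j) p.2 hpI) hεpos.le
    rw [Finset.sum_const, Finset.card_univ, Fintype.card_fin, nsmul_eq_mul] at h1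
    have hgt : u₀ (1 + σ) < u₀ p.2 := by linarith
    have hpV : p ∈ V := by
      refine ⟨lt_of_le_of_ne hpI'.1 fun h => ?_, lt_of_le_of_ne hpI'.2 fun h => ?_⟩
      · rw [← h, show -1 - σ = -(1 + σ) by ring, hu₀even] at hgt
        exact lt_irrefl _ hgt
      · rw [h] at hgt
        exact lt_irrefl _ hgt
    refine ⟨hpV, le_antisymm ?_ hfp⟩
    by_contra! hpos
    rw [hUopen.frontier_eq] at hp
    exact hp.2 ⟨hpV, hpos⟩
  rw [hOme]
  refine ⟨fun p hp => ?_, fun p hp s hs => starConvex_zero_iff.1 hstar hp hs.1.le hs.2,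
    fun p hp => ?_⟩
  · obtain ⟨hpV, hfp⟩ := hfront p hp
    rw [sum_mul_fderiv_eq_radial]
    exact hfrad p hpV hfp
  · obtain ⟨hpV, hfp⟩ := hfront p hp
    refine ⟨fun q => -f q, (hfC1 p hpV).neg, fun h => ?_, ?_⟩
    · have h1 := hfrad p hpV hfp
      rw [fderiv_fun_neg, neg_eq_zero] at h
      rw [h, zero_apply] at h1
      linarith
    · filter_upwards [hVopen.mem_nhds hpV] with q hq
      rw [neg_lt_zero]
      exact ⟨fun h => h.2, fun h => ⟨hq, h⟩⟩
end
end

section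
/- Let N ≥ 1, η > 0, λ > 0, let f : ℝ → ℝ be C¹ and convex, and let Ω ⊆ ℝ^N × (−1−η, 1+η) be a bounded open set with smooth boundary. Suppose u ∈ C²(closure Ω) satisfies −Δu = λ f(u) in Ω, u = 0 on ∂Ω, and u is stable: for every ξ ∈ C_c^∞(Ω) with ξ ≢ 0, ∫_Ω |∇ξ|² − λ ∫_Ω f'(u) ξ² > 0. Let w ∈ C²([−1−η,1+η]) satisfy −w'' = λ f(w) on (−1−η,1+η), w > 0 on (−1−η,1+η), and w(±(1+η)) = 0. Then u(x,y) ≤ w(y) for every (x,y) ∈ Ω. -/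
open MeasureTheory Set Filter Topology

noncomputable section

/-- Second directional derivative of `u` at `p` along `v`. -/
def D2 {N : ℕ} (u : Pt N → ℝ) (v : Pt N) (p : Pt N) : ℝ :=
  fderiv ℝ (fun q => fderiv ℝ u q v) p v

/-- The Laplacian of `u` at `p`. -/
def lap {N : ℕ} (u : Pt N → ℝ) (p : Pt N) : ℝ :=
  (∑ j : Fin N, D2 u (Pi.single j 1, 0) p) + D2 u (0, 1) p

/-- Squared Euclidean norm of the gradient of `u` at `p`. -/
def gradSq {N : ℕ} (u : Pt N → ℝ) (p : Pt N) : ℝ :=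
  (∑ j : Fin N, (fderiv ℝ u p (Pi.single j 1, 0)) ^ 2) + (fderiv ℝ u p (0, 1)) ^ 2

/-- `Ω` has smooth boundary. -/
def SmoothBoundary {N : ℕ} (Ω : Set (Pt N)) : Prop :=
  ∀ p ∈ frontier Ω, ∃ F : Pt N → ℝ,
    ContDiffAt ℝ (⊤ : ℕ∞) F p ∧ fderiv ℝ F p ≠ 0 ∧ ∀ᶠ q in nhds p, (q ∈ Ω ↔ F q < 0)

lemma tsupport_indicator_subset_of_eqOn_zero {X : Type*} [TopologicalSpace X]
    {Ω K : Set X} (hK : IsClosed K) {g : X → ℝ} (h0 : ∀ p ∈ Ω \ K, g p = 0) : tsupport (Ω.indicator g) ⊆ K := by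
  refine closure_minimal (fun p hp => ?_) hK
  by_contra hpK
  obtain ⟨hpΩ, hgp⟩ := indicator_apply_ne_zero.1 hp
  exact hgp (h0 p ⟨hpΩ, hpK⟩)

section Auxiliary

variable {E : Type*} [NormedAddCommGroup E] [NormedSpace ℝ E]

/-- Extension by zero keeps smoothness when the function vanishes off a closed subset. -/
lemma contDiff_indicator_of_eqOn_zero {n : WithTop ℕ∞} {Ω K : Set E} (hΩ : IsOpen Ω)
    (hK : IsClosed K) (hKΩ : K ⊆ Ω) {g : E → ℝ} (hg : ContDiffOn ℝ n g Ω)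
    (h0 : ∀ p ∈ Ω \ K, g p = 0) : ContDiff ℝ n (Ω.indicator g) := by
  rw [contDiff_iff_contDiffAt]
  intro p
  by_cases hp : p ∈ Ω
  · refine (hg.contDiffAt (hΩ.mem_nhds hp)).congr_of_eventuallyEq ?_
    filter_upwards [hΩ.mem_nhds hp] with q hq
    exact indicator_of_mem hq g
  · refine (contDiffAt_const (c := (0 : ℝ))).congr_of_eventuallyEq ?_
    filter_upwards [hK.isOpen_compl.mem_nhds (fun h => hp (hKΩ h))] with q hq
    by_cases hqΩ : q ∈ Ω
    · rw [indicator_of_mem hqΩ, h0 q ⟨hqΩ, hq⟩]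
    · exact indicator_of_notMem hqΩ g

variable [FiniteDimensional ℝ E] [MeasurableSpace E] [BorelSpace E]

lemma integral_fderiv_eq_zero (μ : Measure E) [μ.IsAddHaarMeasure] {F : E → ℝ} (hF : ContDiff ℝ 1 F) (hc : HasCompactSupport F)
    (e : E) : ∫ p, fderiv ℝ F p e ∂μ = 0 := by
  have hd : Integrable (fun p => fderiv ℝ F p e) μ :=
    ((hF.continuous_fderiv one_ne_zero).clm_apply continuous_const).integrable_of_hasCompactSupport
      (hc.fderiv_apply ℝ e)
  have := integral_mul_fderiv_eq_neg_fderiv_mul_of_integrable (μ := μ) (f := fun _ : E => (1 : ℝ))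
    (g := F) (v := e) (by simp) (by simpa using hd)
    (by simpa using hF.continuous.integrable_of_hasCompactSupport hc)
    (fun x _ => by fun_prop) (fun x _ => hF.differentiable one_ne_zero x)
  simpa using this

/-- Compactly supported `C¹` functions are `C¹`-limits of test functions. -/
lemma exists_contDiff_approx {Ω : Set E} (hΩ : IsOpen Ω) {ξ : E → ℝ} (hξ : ContDiff ℝ 1 ξ)
    (hc : HasCompactSupport ξ) (hs : tsupport ξ ⊆ Ω) {δ : ℝ} (hδ : 0 < δ) :
    ∃ ζ : E → ℝ, ContDiff ℝ (⊤ : ℕ∞) ζ ∧ HasCompactSupport ζ ∧ tsupport ζ ⊆ Ω ∧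
      (∀ p, |ζ p - ξ p| ≤ δ) ∧ ∀ p, ‖fderiv ℝ ζ p - fderiv ℝ ξ p‖ ≤ δ := by
  obtain ⟨r, hr, hrΩ⟩ := hc.isCompact.exists_cthickening_subset_open hΩ hs
  have hu := hc.uniformContinuous_of_continuous hξ.continuous
  have hcont' := hξ.continuous_fderiv one_ne_zero
  have hu' := (hc.fderiv ℝ).uniformContinuous_of_continuous hcont'
  obtain ⟨r₁, hr₁, h₁⟩ := Metric.uniformContinuous_iff.1 hu δ hδ
  obtain ⟨r₂, hr₂, h₂⟩ := Metric.uniformContinuous_iff.1 hu' δ hδ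
  let R := min r (min r₁ r₂)
  have hR : 0 < R := lt_min hr (lt_min hr₁ hr₂)
  let φ : ContDiffBump (0 : E) := ⟨R / 2, R, half_pos hR, half_lt_self hR⟩
  let μ : Measure E := Measure.addHaar
  let L := ContinuousLinearMap.lsmul ℝ ℝ (E := ℝ)
  let ζ : E → ℝ := convolution (φ.normed μ) ξ L μ
  have hφc : HasCompactSupport (φ.normed μ) := φ.hasCompactSupport_normed
  have hφcont : Continuous (φ.normed μ) := φ.continuous_normed
  have hloc : LocallyIntegrable (φ.normed μ) μ := hφcont.locallyIntegrable
  have hsupp : tsupport ζ ⊆ Metric.cthickening r (tsupport ξ) := by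
    refine closure_minimal (fun p hp => ?_) Metric.isClosed_cthickening
    obtain ⟨a, ha, b, hb, rfl⟩ := support_convolution_subset L hp
    refine Metric.mem_cthickening_of_dist_le _ b _ _ (subset_tsupport _ hb) ?_
    have haR : a ∈ Metric.ball (0 : E) R := by simpa [φ.support_normed_eq] using ha
    rw [dist_eq_norm, add_sub_cancel_right]
    exact (mem_ball_zero_iff.1 haR).le.trans (min_le_left _ _)
  refine ⟨ζ, hφc.contDiff_convolution_left L φ.contDiff_normed hξ.continuous.locallyIntegrable,
    HasCompactSupport.convolution L hφc hc, hsupp.trans hrΩ, fun p => ?_, fun p => ?_⟩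
  · rw [← Real.dist_eq]
    exact φ.dist_normed_convolution_le hξ.continuous.aestronglyMeasurable fun x hx =>
      (h₁ ((Metric.mem_ball.1 hx).trans_le ((min_le_right _ _).trans (min_le_left _ _)))).le
  · rw [(hc.hasFDerivAt_convolution_right L hloc hξ p).fderiv, ← dist_eq_norm]
    have key := φ.dist_normed_convolution_le (μ := μ) (x₀ := p) (ε := δ)
      hcont'.aestronglyMeasurable fun x hx =>
      (h₂ ((Metric.mem_ball.1 hx).trans_le ((min_le_right _ _).trans (min_le_right _ _)))).le
    convert key using 3
    ext
    rfl

end Auxiliary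

section Truncation

/-- `C¹` approximations `G` of the positive part, with a primitive `H` of `(G')²`. -/
lemma exists_posPart_approx {ε : ℝ} (hε : 0 < ε) : ∃ G H : ℝ → ℝ,
    ContDiff ℝ 1 G ∧ ContDiff ℝ 1 H ∧ (∀ s, deriv H s = deriv G s ^ 2) ∧
    (∀ s ≤ ε, G s = 0) ∧ (∀ s ≤ ε, H s = 0) ∧
    (∀ s, max s 0 - 2 * ε ≤ H s) ∧ (∀ s, 0 ≤ H s) ∧ (∀ s, H s ≤ G s) ∧
    (∀ s, G s ≤ max s 0) := by
  let g : ℝ → ℝ := fun s => max 0 (min 1 (s / ε - 1))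
  have hg : Continuous g := by fun_prop
  have g0 : ∀ s, 0 ≤ g s := fun s => le_max_left _ _
  have g1 : ∀ s, g s ≤ 1 := fun s => max_le zero_le_one (min_le_left _ _)
  have gl : ∀ s ≤ ε, g s = 0 := fun s hs => by
    refine max_eq_left ((min_le_right _ _).trans ?_)
    rw [sub_nonpos, div_le_one hε]
    exact hs
  have gr : ∀ s, 2 * ε ≤ s → g s = 1 := fun s hs => by
    have : 1 ≤ s / ε - 1 := by
      rw [le_sub_iff_add_le, le_div_iff₀ hε]
      linarith
    simp only [g, min_eq_left this]
    norm_num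
  have prim : ∀ k : ℝ → ℝ, Continuous k → ∀ s, HasDerivAt (fun s => ∫ x in ε..s, k x) (k s) s :=
    fun k hk s => intervalIntegral.integral_hasDerivAt_right (hk.intervalIntegrable _ _)
      hk.stronglyMeasurable.stronglyMeasurableAtFilter hk.continuousAt
  have c1 : ∀ k : ℝ → ℝ, Continuous k → ContDiff ℝ 1 (fun s => ∫ x in ε..s, k x) := by
    intro k hk
    rw [contDiff_one_iff_deriv]
    refine ⟨fun s => (prim k hk s).differentiableAt, ?_⟩
    convert hk using 1
    exact funext fun s => (prim k hk s).deriv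
  have hg2 : Continuous (fun s => g s ^ 2) := hg.pow 2
  have left0 : ∀ k : ℝ → ℝ, (∀ s ≤ ε, k s = 0) → ∀ s ≤ ε, ∫ x in ε..s, k x = 0 := by
    intro k hk s hs
    rw [intervalIntegral.integral_symm, neg_eq_zero]
    refine intervalIntegral.integral_zero_ae (Eventually.of_forall fun x hx => ?_)
    rw [uIoc_of_le hs] at hx
    exact hk x hx.2
  have gl2 : ∀ s ≤ ε, g s ^ 2 = 0 := fun s hs => by rw [gl s hs]; norm_num
  refine ⟨fun s => ∫ x in ε..s, g x, fun s => ∫ x in ε..s, g x ^ 2, c1 _ hg, c1 _ hg2,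
    fun s => ?_, left0 _ gl, left0 _ gl2, fun s => ?_, fun s => ?_, fun s => ?_, fun s => ?_⟩
  · rw [(prim _ hg s).deriv, (prim _ hg2 s).deriv]
  · rcases le_total s (2 * ε) with hs | hs
    · have : max s 0 - 2 * ε ≤ 0 := by
        have := max_le hs (by positivity : (0 : ℝ) ≤ 2 * ε)
        linarith
      refine this.trans ?_
      rcases le_total s ε with h | h
      · exact (left0 _ gl2 s h).ge
      · exact intervalIntegral.integral_nonneg h fun x _ => sq_nonneg _
    · have h1 : ∫ x in ε..s, g x ^ 2 = (∫ x in ε..(2 * ε), g x ^ 2) + ∫ x in (2 * ε)..s, g x ^ 2 :=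
        (intervalIntegral.integral_add_adjacent_intervals (hg2.intervalIntegrable _ _)
          (hg2.intervalIntegrable _ _)).symm
      have h2 : ∫ x in (2 * ε)..s, g x ^ 2 = s - 2 * ε := by
        rw [intervalIntegral.integral_congr (g := fun _ => (1 : ℝ))]
        · simp
        · intro x hx
          rw [uIcc_of_le hs] at hx
          simp [gr x hx.1]
      have h3 : 0 ≤ ∫ x in ε..(2 * ε), g x ^ 2 :=
        intervalIntegral.integral_nonneg (by linarith) fun x _ => sq_nonneg _
      simp only
      rw [h1, h2, max_eq_left (by linarith)]
      linarith
  · rcases le_total s ε with h | h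
    · exact (left0 _ gl2 s h).ge
    · exact intervalIntegral.integral_nonneg h fun x _ => sq_nonneg _
  · rcases le_total s ε with h | h
    · simp only
      rw [left0 _ gl2 s h, left0 _ gl s h]
    · refine intervalIntegral.integral_mono_on h (hg2.intervalIntegrable _ _)
        (hg.intervalIntegrable _ _) fun x _ => ?_
      nlinarith [g0 x, g1 x]
  · rcases le_total s ε with h | h
    · simp only
      rw [left0 _ gl s h]
      exact le_max_right _ _
    · have : ∫ x in ε..s, g x ≤ ∫ x in ε..s, (1 : ℝ) :=
        intervalIntegral.integral_mono_on h (hg.intervalIntegrable _ _)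
          (continuous_const.intervalIntegrable _ _) fun x _ => g1 x
      simp at this
      exact (this.trans (by linarith)).trans (le_max_left _ _)

end Truncation

section Energy

variable {N : ℕ} {Ω K : Set (Pt N)}

lemma integrableOn_of_eqOn_zero (hΩ : IsOpen Ω) (hK : IsCompact K) (hKΩ : K ⊆ Ω)
    {g : Pt N → ℝ} (hg : ContinuousOn g Ω) (h0 : ∀ p ∈ Ω \ K, g p = 0) :
    IntegrableOn g Ω := by
  rw [← integrable_indicator_iff hΩ.measurableSet]
  refine Continuous.integrable_of_hasCompactSupport ?_
    (hK.of_isClosed_subset (isClosed_tsupport _)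
      (tsupport_indicator_subset_of_eqOn_zero hK.isClosed h0))
  exact (contDiff_indicator_of_eqOn_zero hΩ hK.isClosed hKΩ (contDiffOn_zero.2 hg) h0).continuous

lemma contDiffOn_fderiv_apply (hΩ : IsOpen Ω) {v : Pt N → ℝ} (hv : ContDiffOn ℝ 2 v Ω)
    (e : Pt N) : ContDiffOn ℝ 1 (fun q => fderiv ℝ v q e) Ω :=
  (hv.fderiv_of_isOpen hΩ (by norm_num)).clm_apply contDiffOn_const

lemma continuousOn_D2 (hΩ : IsOpen Ω) {v : Pt N → ℝ} (hv : ContDiffOn ℝ 2 v Ω)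
    (e : Pt N) : ContinuousOn (D2 v e) Ω :=
  ((contDiffOn_fderiv_apply hΩ hv e).continuousOn_fderiv_of_isOpen hΩ le_rfl).clm_apply
    continuousOn_const

lemma continuousOn_lap (hΩ : IsOpen Ω) {v : Pt N → ℝ} (hv : ContDiffOn ℝ 2 v Ω) :
    ContinuousOn (lap v) Ω :=
  (continuousOn_finsetSum _ fun _ _ => continuousOn_D2 hΩ hv _).add (continuousOn_D2 hΩ hv _)

lemma integral_deriv_comp_mul_sq_add (hΩ : IsOpen Ω) (hK : IsCompact K) (hKΩ : K ⊆ Ω)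
    {v : Pt N → ℝ} (hv : ContDiffOn ℝ 2 v Ω) {H : ℝ → ℝ} (hH : ContDiff ℝ 1 H)
    (h0 : ∀ p ∈ Ω \ K, H (v p) = 0) (e : Pt N) :
    IntegrableOn (fun p => deriv H (v p) * (fderiv ℝ v p e) ^ 2 + H (v p) * D2 v e p) Ω ∧
    ∫ p in Ω, (deriv H (v p) * (fderiv ℝ v p e) ^ 2 + H (v p) * D2 v e p) = 0 := by
  have hHaar : (volume : Measure (Pt N)).IsAddHaarMeasure := by
    rw [Measure.volume_eq_prod]
    infer_instance
  let g : Pt N → ℝ := fun p => H (v p) * fderiv ℝ v p e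
  have hg0 : ∀ p ∈ Ω \ K, g p = 0 := fun p hp => by simp [g, h0 p hp]
  have hve := contDiffOn_fderiv_apply hΩ hv e
  have hg : ContDiffOn ℝ 1 g Ω :=
    (hH.comp_contDiffOn (hv.of_le (by norm_num))).mul hve
  have hF := contDiff_indicator_of_eqOn_zero hΩ hK.isClosed hKΩ hg hg0
  have hts := tsupport_indicator_subset_of_eqOn_zero hK.isClosed hg0
  have hc : HasCompactSupport (Ω.indicator g) :=
    hK.of_isClosed_subset (isClosed_tsupport _) hts
  have hEq : EqOn (fun p => fderiv ℝ (Ω.indicator g) p e)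
      (fun p => deriv H (v p) * (fderiv ℝ v p e) ^ 2 + H (v p) * D2 v e p) Ω := by
    intro p hp
    have hnear : Ω.indicator g =ᶠ[𝓝 p] g := by
      filter_upwards [hΩ.mem_nhds hp] with q hq
      exact indicator_of_mem hq g
    have hvp : HasFDerivAt v (fderiv ℝ v p) p :=
      ((hv.contDiffAt (hΩ.mem_nhds hp)).differentiableAt (by norm_num)).hasFDerivAt
    have hvep := ((hve.contDiffAt (hΩ.mem_nhds hp)).differentiableAt one_ne_zero).hasFDerivAt
    have hHp := ((hH.differentiable one_ne_zero) (v p)).hasDerivAt.comp_hasFDerivAt p hvp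
    have := (hHp.mul hvep).fderiv
    simp only [hnear.fderiv_eq]
    change fderiv ℝ (fun q => H (v q) * fderiv ℝ v q e) p e = _
    change fderiv ℝ (fun q => H (v q) * fderiv ℝ v q e) p = _ at this
    rw [this]
    simp only [D2, add_apply, smul_apply, smul_eq_mul,
      Function.comp]
    ring
  have hint : Integrable (fun p => fderiv ℝ (Ω.indicator g) p e) :=
    ((hF.continuous_fderiv one_ne_zero).clm_apply continuous_const).integrable_of_hasCompactSupport
      (hc.fderiv_apply ℝ e)
  refine ⟨hint.integrableOn.congr_fun hEq hΩ.measurableSet, ?_⟩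
  rw [← setIntegral_congr_fun hΩ.measurableSet hEq, setIntegral_eq_integral_of_forall_compl_eq_zero,
    integral_fderiv_eq_zero volume hF hc]
  intro p hp
  have : p ∉ tsupport (fun q => fderiv ℝ (Ω.indicator g) q e) := fun h =>
    hp (hKΩ (hts (tsupport_fderiv_apply_subset ℝ e h)))
  exact image_eq_zero_of_notMem_tsupport (f := fun q => fderiv ℝ (Ω.indicator g) q e) this

lemma integral_deriv_comp_mul_gradSq_add (hΩ : IsOpen Ω) (hK : IsCompact K) (hKΩ : K ⊆ Ω)
    {v : Pt N → ℝ} (hv : ContDiffOn ℝ 2 v Ω) {H : ℝ → ℝ} (hH : ContDiff ℝ 1 H)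
    (h0 : ∀ p ∈ Ω \ K, H (v p) = 0) :
    IntegrableOn (fun p => deriv H (v p) * gradSq v p + H (v p) * lap v p) Ω ∧
    ∫ p in Ω, (deriv H (v p) * gradSq v p + H (v p) * lap v p) = 0 := by
  have key := integral_deriv_comp_mul_sq_add hΩ hK hKΩ hv hH h0
  have hEq : (fun p => deriv H (v p) * gradSq v p + H (v p) * lap v p) = fun p =>
      (∑ j : Fin N, (deriv H (v p) * (fderiv ℝ v p (Pi.single j 1, 0)) ^ 2
        + H (v p) * D2 v (Pi.single j 1, 0) p))
      + (deriv H (v p) * (fderiv ℝ v p (0, 1)) ^ 2 + H (v p) * D2 v (0, 1) p) := by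
    funext p
    simp only [gradSq, lap, Finset.sum_add_distrib, ← Finset.mul_sum]
    ring
  have hsum := integrable_finsetSum (μ := volume.restrict Ω) Finset.univ
    fun (j : Fin N) _ => (key (Pi.single j 1, 0)).1
  rw [hEq]
  refine ⟨hsum.add (key (0, 1)).1, ?_⟩
  rw [integral_add hsum (key (0, 1)).1, integral_finsetSum _ fun j _ => (key _).1, (key (0, 1)).2]
  simp [(key _).2]

lemma continuous_gradSq {ξ : Pt N → ℝ} (hξ : ContDiff ℝ 1 ξ) : Continuous (gradSq ξ) := by
  have := hξ.continuous_fderiv one_ne_zero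
  unfold gradSq
  fun_prop

/-- The stability inequality passes from test functions to `C¹` functions of compact support. -/
lemma nonneg_of_stable (hΩ : IsOpen Ω) (hΩbd : Bornology.IsBounded Ω) {lam C : ℝ}
    {V : Pt N → ℝ} (hV : ContinuousOn V Ω) (hVC : ∀ p ∈ Ω, |V p| ≤ C)
    (hstab : ∀ ξ : Pt N → ℝ, ContDiff ℝ (⊤ : ℕ∞) ξ → HasCompactSupport ξ → tsupport ξ ⊆ Ω →
      ξ ≠ 0 → 0 < (∫ p in Ω, gradSq ξ p) - lam * ∫ p in Ω, V p * (ξ p) ^ 2)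
    {ξ : Pt N → ℝ} (hξ : ContDiff ℝ 1 ξ) (hc : HasCompactSupport ξ) (hs : tsupport ξ ⊆ Ω) :
    0 ≤ (∫ p in Ω, gradSq ξ p) - lam * ∫ p in Ω, V p * (ξ p) ^ 2 := by
  have hfin : IsFiniteMeasure (volume.restrict Ω) := ⟨by simpa using hΩbd.measure_lt_top⟩
  choose ζ hζ hζc hζs hζ0 hζ1 using fun n : ℕ =>
    exists_contDiff_approx hΩ hξ hc hs (δ := 1 / ((n : ℝ) + 1)) (by positivity)
  have hδ1 : ∀ n : ℕ, 1 / ((n : ℝ) + 1) ≤ 1 := fun n => by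
    rw [div_le_one (by positivity)]
    linarith [n.cast_nonneg (α := ℝ)]
  have hδ0 : Tendsto (fun n : ℕ => 1 / ((n : ℝ) + 1)) atTop (𝓝 0) :=
    tendsto_one_div_add_atTop_nhds_zero_nat
  have hlim0 : ∀ p, Tendsto (fun n => ζ n p) atTop (𝓝 (ξ p)) := fun p => by
    rw [tendsto_iff_dist_tendsto_zero]
    exact squeeze_zero (fun _ => dist_nonneg) (fun n => (Real.dist_eq _ _).trans_le (hζ0 n p)) hδ0
  have hlim1 : ∀ p, Tendsto (fun n => fderiv ℝ (ζ n) p) atTop (𝓝 (fderiv ℝ ξ p)) := fun p => by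
    rw [tendsto_iff_dist_tendsto_zero]
    exact squeeze_zero (fun _ => dist_nonneg) (fun n => (dist_eq_norm _ _).trans_le (hζ1 n p)) hδ0
  obtain ⟨M₀, hM₀⟩ := hc.exists_bound_of_continuous hξ.continuous
  obtain ⟨M₁, hM₁⟩ := (hc.fderiv ℝ).exists_bound_of_continuous (hξ.continuous_fderiv one_ne_zero)
  have hb0 : ∀ n p, |ζ n p| ≤ M₀ + 1 := fun n p => by
    have h1 := hM₀ p
    rw [Real.norm_eq_abs] at h1
    have h2 := (hζ0 n p).trans (hδ1 n)
    rw [abs_le] at *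
    constructor <;> linarith
  have hb1 : ∀ n p, ‖fderiv ℝ (ζ n) p‖ ≤ M₁ + 1 := fun n p => by
    have h2 := (hζ1 n p).trans (hδ1 n)
    have h3 := norm_le_norm_add_norm_sub' (fderiv ℝ (ζ n) p) (fderiv ℝ ξ p)
    linarith [hM₁ p]
  have hb2 : ∀ n p e, (fderiv ℝ (ζ n) p e) ^ 2 ≤ ((M₁ + 1) * ‖e‖) ^ 2 := fun n p e => by
    rw [← sq_abs]
    gcongr
    exact ((fderiv ℝ (ζ n) p).le_opNorm e).trans (by gcongr; exact hb1 n p)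
  have hgrad : Tendsto (fun n => ∫ p in Ω, gradSq (ζ n) p) atTop (𝓝 (∫ p in Ω, gradSq ξ p)) := by
    refine tendsto_integral_of_dominated_convergence
      (fun _ => (∑ j : Fin N, ((M₁ + 1) * ‖((Pi.single j 1, 0) : Pt N)‖) ^ 2)
        + ((M₁ + 1) * ‖((0, 1) : Pt N)‖) ^ 2)
      (fun n => (continuous_gradSq ((hζ n).of_le (by exact_mod_cast le_top))).aestronglyMeasurable)
      (integrable_const _) (fun n => Eventually.of_forall fun p => ?_)
      (Eventually.of_forall fun p => ?_)
    · rw [Real.norm_of_nonneg (by unfold gradSq; positivity)]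
      exact add_le_add (Finset.sum_le_sum fun j _ => hb2 _ _ _) (hb2 _ _ _)
    · have happ : ∀ e, Tendsto (fun n => (fderiv ℝ (ζ n) p e) ^ 2) atTop
          (𝓝 ((fderiv ℝ ξ p e) ^ 2)) := fun e =>
        (((ContinuousLinearMap.apply ℝ ℝ e).continuous.tendsto _).comp (hlim1 p)).pow 2
      exact (tendsto_finsetSum _ fun j _ => happ _).add (happ _)
  have hpot : Tendsto (fun n => ∫ p in Ω, V p * (ζ n p) ^ 2) atTop
      (𝓝 (∫ p in Ω, V p * (ξ p) ^ 2)) := by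
    refine tendsto_integral_of_dominated_convergence (fun _ => C * (M₀ + 1) ^ 2)
      (fun n => (hV.mul ((hζ n).continuous.pow 2).continuousOn).aestronglyMeasurable
        hΩ.measurableSet)
      (integrable_const _) (fun n => ?_) (Eventually.of_forall fun p => ?_)
    · filter_upwards [ae_restrict_mem hΩ.measurableSet] with p hp
      rw [norm_mul, norm_pow, Real.norm_eq_abs, Real.norm_eq_abs]
      have := hVC p hp
      have := (abs_nonneg _).trans this
      gcongr
      exact hb0 n p
    · exact tendsto_const_nhds.mul ((hlim0 p).pow 2)
  refine ge_of_tendsto' (hgrad.sub (hpot.const_mul lam)) fun n => ?_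
  by_cases h0 : ζ n = 0
  · simp [h0, gradSq]
  · exact (hstab _ (hζ n) (hζc n) (hζs n) h0).le

lemma nonneg_of_stable_comp (hΩ : IsOpen Ω) (hΩbd : Bornology.IsBounded Ω) {lam C : ℝ}
    {V : Pt N → ℝ} (hV : ContinuousOn V Ω) (hVC : ∀ p ∈ Ω, |V p| ≤ C)
    (hstab : ∀ ξ : Pt N → ℝ, ContDiff ℝ (⊤ : ℕ∞) ξ → HasCompactSupport ξ → tsupport ξ ⊆ Ω →
      ξ ≠ 0 → 0 < (∫ p in Ω, gradSq ξ p) - lam * ∫ p in Ω, V p * (ξ p) ^ 2)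
    (hK : IsCompact K) (hKΩ : K ⊆ Ω) {v : Pt N → ℝ} (hv : ContDiffOn ℝ 2 v Ω)
    {G H : ℝ → ℝ} (hG : ContDiff ℝ 1 G) (hH : ContDiff ℝ 1 H)
    (hGH : ∀ s, deriv H s = deriv G s ^ 2) (hG0 : ∀ p ∈ Ω \ K, G (v p) = 0)
    (hH0 : ∀ p ∈ Ω \ K, H (v p) = 0) :
    IntegrableOn (fun p => H (v p) * (-lap v p) - lam * V p * G (v p) ^ 2) Ω ∧
    0 ≤ ∫ p in Ω, (H (v p) * (-lap v p) - lam * V p * G (v p) ^ 2) := by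
  have hGv : ContDiffOn ℝ 1 (fun p => G (v p)) Ω := hG.comp_contDiffOn (hv.of_le (by norm_num))
  have hHv : ContDiffOn ℝ 1 (fun p => H (v p)) Ω := hH.comp_contDiffOn (hv.of_le (by norm_num))
  let ξ : Pt N → ℝ := Ω.indicator fun p => G (v p)
  have hts : tsupport ξ ⊆ K := tsupport_indicator_subset_of_eqOn_zero hK.isClosed hG0
  have h := nonneg_of_stable hΩ hΩbd hV hVC hstab
    (contDiff_indicator_of_eqOn_zero hΩ hK.isClosed hKΩ hGv hG0)
    (hK.of_isClosed_subset (isClosed_tsupport _) hts) (hts.trans hKΩ)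
  have hξG : EqOn ξ (fun p => G (v p)) Ω := fun p hp => indicator_of_mem hp _
  have hgrad : EqOn (gradSq ξ) (fun p => (deriv H (v p) * gradSq v p + H (v p) * lap v p)
      + H (v p) * (-lap v p)) Ω := by
    intro p hp
    have hnear : ξ =ᶠ[𝓝 p] fun q => G (v q) := by
      filter_upwards [hΩ.mem_nhds hp] with q hq
      exact hξG hq
    have hvp : HasFDerivAt v (fderiv ℝ v p) p :=
      ((hv.contDiffAt (hΩ.mem_nhds hp)).differentiableAt (by norm_num)).hasFDerivAt
    have hd : fderiv ℝ ξ p = deriv G (v p) • fderiv ℝ v p := by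
      rw [hnear.fderiv_eq]
      exact (((hG.differentiable one_ne_zero) (v p)).hasDerivAt.comp_hasFDerivAt p hvp).fderiv
    simp only [gradSq, hd, hGH, smul_apply, smul_eq_mul, mul_pow,
      ← Finset.mul_sum]
    ring
  have hI := integral_deriv_comp_mul_gradSq_add hΩ hK hKΩ hv hH hH0
  have hIlap : IntegrableOn (fun p => H (v p) * (-lap v p)) Ω :=
    integrableOn_of_eqOn_zero hΩ hK hKΩ (hHv.continuousOn.mul (continuousOn_lap hΩ hv).neg)
      fun p hp => by simp [hH0 p hp]
  have hIV : IntegrableOn (fun p => lam * V p * G (v p) ^ 2) Ω :=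
    integrableOn_of_eqOn_zero hΩ hK hKΩ
      ((continuousOn_const.mul hV).mul (hGv.continuousOn.pow 2)) fun p hp => by simp [hG0 p hp]
  refine ⟨hIlap.sub hIV, ?_⟩
  change 0 ≤ (∫ p in Ω, gradSq ξ p) - lam * ∫ p in Ω, V p * (ξ p) ^ 2 at h
  rw [setIntegral_congr_fun hΩ.measurableSet hgrad, integral_add hI.1 hIlap, hI.2, zero_add,
    ← integral_const_mul] at h
  rw [integral_sub hIlap hIV]
  convert h using 2
  refine setIntegral_congr_fun hΩ.measurableSet fun p hp => ?_
  simp only [hξG hp]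
  ring

end Energy

section Laplacian

variable {N : ℕ} {p : Pt N}

lemma differentiableAt_fderiv_apply {a : Pt N → ℝ} (ha : ContDiffAt ℝ 2 a p) (e : Pt N) :
    DifferentiableAt ℝ (fun q => fderiv ℝ a q e) p :=
  ((ha.fderiv_right (m := 1) (by norm_num)).differentiableAt one_ne_zero).clm_apply
    (differentiableAt_const e)

lemma D2_add_const_mul {a b : Pt N → ℝ} (ha : ContDiffAt ℝ 2 a p) (hb : ContDiffAt ℝ 2 b p)
    (c : ℝ) (e : Pt N) : D2 (fun q => a q + c * b q) e p = D2 a e p + c * D2 b e p := by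
  have hda := differentiableAt_fderiv_apply ha e
  have hdb := differentiableAt_fderiv_apply hb e
  have hnear : (fun q => fderiv ℝ (fun q => a q + c * b q) q e) =ᶠ[𝓝 p]
      fun q => fderiv ℝ a q e + c * fderiv ℝ b q e := by
    filter_upwards [ha.eventually (by simp), hb.eventually (by simp)] with q hqa hqb
    have hqa' := (hqa.differentiableAt (by norm_num)).hasFDerivAt
    have hqb' := (hqb.differentiableAt (by norm_num)).hasFDerivAt
    have := (hqa'.add (hqb'.const_mul c)).fderiv
    change fderiv ℝ (fun q => a q + c * b q) q = _ at this
    rw [this]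
    simp
  have := (hda.hasFDerivAt.add (hdb.hasFDerivAt.const_mul c)).fderiv
  change fderiv ℝ (fun q => fderiv ℝ a q e + c * fderiv ℝ b q e) p = _ at this
  rw [D2, hnear.fderiv_eq, this]
  simp [D2]

lemma lap_add_const_mul {a b : Pt N → ℝ} (ha : ContDiffAt ℝ 2 a p) (hb : ContDiffAt ℝ 2 b p)
    (c : ℝ) : lap (fun q => a q + c * b q) p = lap a p + c * lap b p := by
  simp only [lap, D2_add_const_mul ha hb, Finset.sum_add_distrib, ← Finset.mul_sum]
  ring

lemma D2_mul_coord {A A' B B' : ℝ → ℝ} {A'' B'' : ℝ} (j : Fin N)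
    (hA : ∀ x, HasDerivAt A (A' x) x) (hA' : HasDerivAt A' A'' (p.1 j))
    (hB : ∀ᶠ y in 𝓝 p.2, HasDerivAt B (B' y) y) (hB' : HasDerivAt B' B'' p.2) (e : Pt N) :
    D2 (fun q : Pt N => A (q.1 j) * B q.2) e p =
      A'' * e.1 j ^ 2 * B p.2 + 2 * (A' (p.1 j) * B' p.2 * (e.1 j * e.2))
        + A (p.1 j) * B'' * e.2 ^ 2 := by
  let X : Pt N →L[ℝ] ℝ :=
    (ContinuousLinearMap.proj (R := ℝ) (φ := fun _ : Fin N => ℝ) j).comp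
      (ContinuousLinearMap.fst ℝ (Fin N → ℝ) ℝ)
  let Y : Pt N →L[ℝ] ℝ := ContinuousLinearMap.snd ℝ (Fin N → ℝ) ℝ
  have hX : ∀ q : Pt N, HasFDerivAt (fun q : Pt N => q.1 j) X q := fun q => X.hasFDerivAt
  have hY : ∀ q : Pt N, HasFDerivAt (fun q : Pt N => q.2) Y q := fun q => Y.hasFDerivAt
  have hnear : (fun q => fderiv ℝ (fun q : Pt N => A (q.1 j) * B q.2) q e) =ᶠ[𝓝 p]
      fun q => A (q.1 j) * (B' q.2 * e.2) + B q.2 * (A' (q.1 j) * e.1 j) := by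
    filter_upwards [(continuous_snd.tendsto p).eventually hB] with q hq
    have := (((hA (q.1 j)).comp_hasFDerivAt q (hX q)).mul (hq.comp_hasFDerivAt q (hY q))).fderiv
    change fderiv ℝ (fun q : Pt N => A (q.1 j) * B q.2) q = _ at this
    rw [this]
    simp [X, Y]
  have hAp := (hA (p.1 j)).comp_hasFDerivAt p (hX p)
  have hA'p := hA'.comp_hasFDerivAt p (hX p)
  have hBp := hB.self_of_nhds.comp_hasFDerivAt p (hY p)
  have hB'p := hB'.comp_hasFDerivAt p (hY p)
  have := ((hAp.mul (hB'p.mul_const e.2)).add (hBp.mul (hA'p.mul_const (e.1 j)))).fderiv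
  change fderiv ℝ (fun q : Pt N => A (q.1 j) * (B' q.2 * e.2) + B q.2 * (A' (q.1 j) * e.1 j)) p
    = _ at this
  rw [D2, hnear.fderiv_eq, this]
  simp [X, Y]
  ring

lemma lap_mul_coord {A A' B B' : ℝ → ℝ} {A'' B'' : ℝ} (j : Fin N)
    (hA : ∀ x, HasDerivAt A (A' x) x) (hA' : HasDerivAt A' A'' (p.1 j))
    (hB : ∀ᶠ y in 𝓝 p.2, HasDerivAt B (B' y) y) (hB' : HasDerivAt B' B'' p.2) :
    lap (fun q : Pt N => A (q.1 j) * B q.2) p = A'' * B p.2 + A (p.1 j) * B'' := by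
  simp only [lap, D2_mul_coord j hA hA' hB hB']
  rw [Finset.sum_eq_single j (fun i _ hij => by simp [Pi.single_eq_of_ne hij.symm]) (by simp)]
  simp

end Laplacian

section Bump

lemma hasDerivAt_posPart_pow (n : ℕ) (x : ℝ) :
    HasDerivAt (fun x : ℝ => max x 0 ^ (n + 2)) ((n + 2 : ℕ) * max x 0 ^ (n + 1)) x := by
  have hne : ∀ y : ℝ, y ≠ 0 →
      HasDerivAt (fun x : ℝ => max x 0 ^ (n + 2)) ((n + 2 : ℕ) * max y 0 ^ (n + 1)) y := by
    intro y hy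
    rcases hy.lt_or_gt with h | h
    · rw [max_eq_right h.le]
      refine HasDerivAt.congr_of_eventuallyEq (f := fun _ => (0 : ℝ))
        (by simpa using hasDerivAt_const y (0 : ℝ)) ?_
      filter_upwards [gt_mem_nhds h] with z hz
      simp [max_eq_right (le_of_lt hz)]
    · rw [max_eq_left h.le]
      refine (hasDerivAt_pow (n + 2) y).congr_of_eventuallyEq ?_
      filter_upwards [lt_mem_nhds h] with z hz
      simp [max_eq_left (le_of_lt hz)]
  rcases eq_or_ne x 0 with rfl | hx
  · exact hasDerivAt_of_hasDerivAt_of_ne hne (by fun_prop) (by fun_prop)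
  · exact hne x hx

lemma contDiff_posPart_cube : ContDiff ℝ 2 (fun x : ℝ => max x 0 ^ 3) := by
  have h1 : ContDiff ℝ 1 (fun x : ℝ => max x 0 ^ 2) := by
    rw [contDiff_one_iff_deriv]
    refine ⟨fun x => (hasDerivAt_posPart_pow 0 x).differentiableAt, ?_⟩
    rw [funext fun x => (hasDerivAt_posPart_pow 0 x).deriv]
    fun_prop
  rw [show (2 : WithTop ℕ∞) = 1 + 1 by norm_num, contDiff_succ_iff_deriv]
  refine ⟨fun x => (hasDerivAt_posPart_pow 1 x).differentiableAt, by simp, ?_⟩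
  rw [funext fun x => (hasDerivAt_posPart_pow 1 x).deriv]
  exact contDiff_const.mul h1

/-- A `C²` function, positive exactly on `(-a, a)`, with `ψ'' ≥ -Kψ`. -/
lemma exists_bump_deriv_ge {a : ℝ} (ha : 0 < a) : ∃ (K : ℝ) (ψ ψ' ψ'' : ℝ → ℝ),
    0 ≤ K ∧ ContDiff ℝ 2 ψ ∧ (∀ y, HasDerivAt ψ (ψ' y) y) ∧ (∀ y, HasDerivAt ψ' (ψ'' y) y) ∧
    (∀ y, 0 ≤ ψ y) ∧ (∀ y, |y| < a → 0 < ψ y) ∧ (∀ y, a ≤ |y| → ψ y = 0) ∧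
    ∀ y, -(K * ψ y) ≤ ψ'' y := by
  let r : ℝ → ℝ := fun y => max (a ^ 2 - y ^ 2) 0
  have hr : ∀ y : ℝ, HasDerivAt (fun y : ℝ => a ^ 2 - y ^ 2) (-(2 * y)) y := fun y => by
    simpa using (hasDerivAt_pow 2 y).const_sub (a ^ 2)
  have hpow : ∀ (n : ℕ) (y : ℝ), HasDerivAt (fun y => r y ^ (n + 2))
      (((n + 2 : ℕ) * r y ^ (n + 1)) * -(2 * y)) y := fun n y =>
    HasDerivAt.comp (h₂ := fun x : ℝ => max x 0 ^ (n + 2)) y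
      (hasDerivAt_posPart_pow n (a ^ 2 - y ^ 2)) (hr y)
  refine ⟨10 / a ^ 2, fun y => r y ^ 3, fun y => -6 * (y * r y ^ 2),
    fun y => -6 * r y ^ 2 + 24 * y ^ 2 * r y, by positivity,
    contDiff_posPart_cube.comp (by fun_prop), fun y => ?_, fun y => ?_,
    fun y => pow_nonneg (le_max_right _ _) _, fun y hy => ?_, fun y hy => ?_, fun y => ?_⟩
  · refine (hpow 1 y).congr_deriv ?_
    push_cast
    ring
  · refine (((hasDerivAt_id y).mul (hpow 0 y)).const_mul (-6 : ℝ)).congr_deriv ?_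
    simp
    ring
  · have : y ^ 2 < a ^ 2 := sq_lt_sq.2 (by rwa [abs_of_pos ha])
    exact pow_pos (lt_max_of_lt_left (by linarith)) _
  · have : a ^ 2 ≤ y ^ 2 := sq_le_sq.2 (by rwa [abs_of_pos ha])
    have : r y = 0 := max_eq_right (by linarith)
    simp [this]
  · rcases le_total (a ^ 2 - y ^ 2) 0 with h | h
    · have : r y = 0 := max_eq_right h
      simp [this]
    · have hry : r y = a ^ 2 - y ^ 2 := max_eq_left h
      have hy : y ^ 2 = a ^ 2 - r y := by rw [hry]; ring
      have h0 : 0 ≤ r y := le_max_right _ _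
      have hq : 0 ≤ 24 * a ^ 2 - 30 * r y + 10 / a ^ 2 * r y ^ 2 := by
        have : 24 * a ^ 2 - 30 * r y + 10 / a ^ 2 * r y ^ 2
            = (10 * (r y - 3 / 2 * a ^ 2) ^ 2 + 3 / 2 * a ^ 4) / a ^ 2 := by
          field_simp
          ring
        rw [this]
        positivity
      simp only
      rw [hy]
      nlinarith [mul_nonneg h0 hq]

end Bump

section MaximumPrinciple

/-- Maximum principle for `-Δ - λV` under the weak (nonstrict) stability of `V`: a subsolution
is nonpositive wherever the inequality is strict. -/
lemma nonpos_of_stable_of_subsolution {N : ℕ} {Ω : Set (Pt N)} (hΩ : IsOpen Ω)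
    (hΩbd : Bornology.IsBounded Ω) {lam : ℝ} {V : Pt N → ℝ} (hV : ContinuousOn V (closure Ω))
    (hstab : ∀ ξ : Pt N → ℝ, ContDiff ℝ (⊤ : ℕ∞) ξ → HasCompactSupport ξ → tsupport ξ ⊆ Ω →
      ξ ≠ 0 → 0 < (∫ p in Ω, gradSq ξ p) - lam * ∫ p in Ω, V p * (ξ p) ^ 2)
    {v ρ : Pt N → ℝ} (hv : ContDiffOn ℝ 2 v Ω) (hvc : ContinuousOn v (closure Ω))
    (hvb : ∀ p ∈ frontier Ω, v p ≤ 0) (hρ : ContinuousOn ρ (closure Ω)) (hρ0 : ∀ p ∈ Ω, 0 ≤ ρ p)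
    (hsub : ∀ p ∈ Ω, -lap v p ≤ lam * V p * v p - ρ p) {p₀ : Pt N} (hp₀ : p₀ ∈ Ω)
    (hρp₀ : 0 < ρ p₀) : v p₀ ≤ 0 := by
  by_contra! hvp₀
  have hcpt : IsCompact (closure Ω) := hΩbd.isCompact_closure
  have hfin : volume Ω < ⊤ := hΩbd.measure_lt_top
  obtain ⟨C, hC⟩ := hcpt.exists_bound_of_continuousOn hV
  obtain ⟨M, hM⟩ := hcpt.exists_bound_of_continuousOn hvc
  obtain ⟨R, hR⟩ := hcpt.exists_bound_of_continuousOn hρ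
  have hC0 : 0 ≤ C := (norm_nonneg _).trans (hC p₀ (subset_closure hp₀))
  have hM0 : 0 ≤ M := (norm_nonneg _).trans (hM p₀ (subset_closure hp₀))
  have hR0 : 0 ≤ R := (norm_nonneg _).trans (hR p₀ (subset_closure hp₀))
  have hpos : ContinuousOn (fun p => ρ p * max (v p) 0) (closure Ω) :=
    hρ.mul (hvc.sup continuousOn_const)
  have hJint : IntegrableOn (fun p => ρ p * max (v p) 0) Ω :=
    (hpos.integrableOn_compact hcpt).mono_set subset_closure
  have hJ : 0 < ∫ p in Ω, ρ p * max (v p) 0 := by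
    rw [setIntegral_pos_iff_support_of_nonneg_ae _ hJint]
    · have hopen : IsOpen (Ω ∩ (fun p => ρ p * max (v p) 0) ⁻¹' Ioi 0) :=
        (hpos.mono subset_closure).isOpen_inter_preimage hΩ isOpen_Ioi
      have hvol : (volume : Measure (Pt N)).IsOpenPosMeasure := by
        rw [Measure.volume_eq_prod]
        infer_instance
      refine (hopen.measure_pos volume
        ⟨p₀, hp₀, mul_pos hρp₀ (lt_max_of_lt_left hvp₀)⟩).trans_le (measure_mono ?_)
      exact fun p hp => ⟨(mem_preimage.1 hp.2).ne', hp.1⟩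
    · filter_upwards [ae_restrict_mem hΩ.measurableSet] with p hp
      exact mul_nonneg (hρ0 p hp) (le_max_right _ _)
  have hbound : ∀ ε > 0, ∫ p in Ω, ρ p * max (v p) 0 ≤
      ε * ((|lam| * C * (4 * M) + 2 * R) * volume.real Ω) := by
    intro ε hε
    obtain ⟨G, H, hG, hH, hGH, hG0, hH0, hHlow, hHnn, hHG, hGup⟩ := exists_posPart_approx hε
    let K : Set (Pt N) := closure Ω ∩ v ⁻¹' Ici ε
    have hK : IsCompact K := hcpt.of_isClosed_subset
      (hvc.preimage_isClosed_of_isClosed isClosed_closure isClosed_Ici) inter_subset_left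
    have hKΩ : K ⊆ Ω := by
      rintro p ⟨hpc, hpv⟩
      by_contra hpΩ
      have := hvb p (by rw [hΩ.frontier_eq]; exact ⟨hpc, hpΩ⟩)
      rw [mem_preimage, mem_Ici] at hpv
      linarith
    have hlow : ∀ p ∈ Ω \ K, v p ≤ ε := fun p hp => by
      by_contra! h
      exact hp.2 ⟨subset_closure hp.1, h.le⟩
    obtain ⟨hint, hnn⟩ := nonneg_of_stable_comp hΩ hΩbd (hV.mono subset_closure)
      (fun p hp => hC p (subset_closure hp)) hstab hK hKΩ hv hG hH hGH
      (fun p hp => hG0 _ (hlow p hp)) (fun p hp => hH0 _ (hlow p hp))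
    have hcint : IntegrableOn (fun _ : Pt N => ε * (|lam| * C * (4 * M) + 2 * R)) Ω :=
      integrableOn_const hfin.ne
    have hmono := setIntegral_mono_on hint (hcint.sub hJint) hΩ.measurableSet fun p hp => by
      have hcp : p ∈ closure Ω := subset_closure hp
      set s := v p
      set m := max s 0 with hm
      have hm0 : 0 ≤ m := le_max_right _ _
      have hmM : m ≤ M := max_le ((le_abs_self _).trans (hM p hcp)) hM0
      have hsm : H s * s = H s * m := by
        rcases le_total s 0 with h | h
        · rw [hH0 s (h.trans hε.le)]
          ring
        · rw [hm, max_eq_left h]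
      have e1 : H s * (-lap v p) ≤ H s * (lam * V p * s - ρ p) :=
        mul_le_mul_of_nonneg_left (hsub p hp) (hHnn s)
      have hVC : |lam * V p| ≤ |lam| * C := by
        rw [abs_mul]
        exact mul_le_mul_of_nonneg_left (hC p hcp) (abs_nonneg _)
      have hGlow := (hHlow s).trans (hHG s)
      have hG0' := (hHnn s).trans (hHG s)
      have hdiff : |H s * m - G s ^ 2| ≤ ε * (4 * M) := by
        have hHm := (hHG s).trans (hGup s)
        have h1 : ε * m ≤ ε * M := mul_le_mul_of_nonneg_left hmM hε.le
        rw [abs_le]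
        constructor
        · nlinarith [mul_le_mul_of_nonneg_right (hHlow s) hm0,
            mul_le_mul_of_nonneg_left (hGup s) hG0', mul_le_mul_of_nonneg_right (hGup s) hm0]
        · nlinarith [mul_le_mul_of_nonneg_right hHm hm0,
            mul_le_mul_of_nonneg_right hGlow hm0, mul_le_mul_of_nonneg_left hGlow hG0',
            mul_le_mul_of_nonneg_right (hGup s) hε.le]
      have e2 : lam * V p * (H s * m - G s ^ 2) ≤ |lam| * C * (ε * (4 * M)) := by
        refine (le_abs_self _).trans ?_
        rw [abs_mul]
        exact mul_le_mul hVC hdiff (abs_nonneg _) (by positivity)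
      have hρR : ρ p ≤ R := (le_abs_self _).trans (hR p hcp)
      have e3 : ρ p * (m - 2 * ε) ≤ ρ p * H s :=
        mul_le_mul_of_nonneg_left (hHlow s) (hρ0 p hp)
      have e4 : ρ p * ε ≤ R * ε := mul_le_mul_of_nonneg_right hρR hε.le
      have e5 : lam * V p * (H s * s) = lam * V p * (H s * m) := by rw [hsm]
      simp only [Pi.sub_apply]
      nlinarith
    simp only [Pi.sub_apply] at hmono
    rw [integral_sub hcint hJint, setIntegral_const, smul_eq_mul] at hmono
    linarith
  set D := (|lam| * C * (4 * M) + 2 * R) * volume.real Ω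
  set J := ∫ p in Ω, ρ p * max (v p) 0
  have hD : 0 ≤ D := by positivity
  have h := hbound (J / (2 * (D + 1))) (by positivity)
  rw [div_mul_eq_mul_div, le_div_iff₀ (by positivity)] at h
  nlinarith

lemma ConvexOn.sub_le_deriv_mul_sub {f : ℝ → ℝ} (hconv : ConvexOn ℝ univ f)
    (hf : Differentiable ℝ f) (x y : ℝ) : f x - f y ≤ deriv f x * (x - y) := by
  rcases lt_trichotomy x y with h | rfl | h
  · have := hconv.deriv_le_slope (mem_univ x) (mem_univ y) h (hf x)
    rw [slope_def_field, le_div_iff₀ (sub_pos.2 h)] at this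
    linarith
  · simp
  · have := hconv.slope_le_deriv (mem_univ y) (mem_univ x) h (hf x)
    rwa [slope_def_field, div_le_iff₀ (sub_pos.2 h)] at this

end MaximumPrinciple

theorem statement9 (N : ℕ) (hN : 1 ≤ N) (η : ℝ) (hη : 0 < η)
    (lam : ℝ) (hlam : 0 < lam)
    (f : ℝ → ℝ) (hf : ContDiff ℝ 1 f) (hconv : ConvexOn ℝ Set.univ f)
    (Ω : Set (Pt N)) (hΩsub : Ω ⊆ {p : Pt N | p.2 ∈ Ioo (-1 - η) (1 + η)})
    (hΩopen : IsOpen Ω) (hΩbd : Bornology.IsBounded Ω) (hΩsm : SmoothBoundary Ω)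
    (u : Pt N → ℝ) (huC : ContDiffOn ℝ 2 u (closure Ω))
    (hueq : ∀ p ∈ Ω, lap u p = -(lam * f (u p)))
    (hub : ∀ p ∈ frontier Ω, u p = 0)
    -- stability of u
    (hstab : ∀ ξ : Pt N → ℝ, ContDiff ℝ (⊤ : ℕ∞) ξ → HasCompactSupport ξ → tsupport ξ ⊆ Ω →
      ξ ≠ 0 →
      0 < (∫ p in Ω, gradSq ξ p) - lam * ∫ p in Ω, deriv f (u p) * (ξ p) ^ 2)
    (w : ℝ → ℝ) (hwC : ContDiffOn ℝ 2 w (Icc (-1 - η) (1 + η)))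
    (hweq : ∀ y ∈ Ioo (-1 - η) (1 + η), -(deriv (deriv w) y) = lam * f (w y))
    (hwpos : ∀ y ∈ Ioo (-1 - η) (1 + η), 0 < w y)
    (hwm : w (-(1 + η)) = 0) (hwp : w (1 + η) = 0) :
    ∀ p ∈ Ω, u p ≤ w p.2 := by
  intro p₀ hp₀
  by_contra! hlt
  let V : Pt N → ℝ := fun p => deriv f (u p)
  have hcpt : IsCompact (closure Ω) := hΩbd.isCompact_closure
  have huc : ContinuousOn u (closure Ω) := huC.continuousOn
  have hV : ContinuousOn V (closure Ω) := (hf.continuous_deriv le_rfl).comp_continuousOn huc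
  obtain ⟨C, hC⟩ := hcpt.exists_bound_of_continuousOn hV
  have hC0 : 0 ≤ C := (norm_nonneg _).trans (hC p₀ (subset_closure hp₀))
  have hstrip : ∀ p ∈ closure Ω, p.2 ∈ Icc (-1 - η) (1 + η) := fun p hp =>
    closure_minimal (t := {p : Pt N | p.2 ∈ Icc (-1 - η) (1 + η)})
      (fun q hq => ⟨(hΩsub hq).1.le, (hΩsub hq).2.le⟩) (isClosed_Icc.preimage continuous_snd) hp
  have hw0 : ∀ y ∈ Icc (-1 - η) (1 + η), 0 ≤ w y := by
    intro y hy
    rcases hy.1.eq_or_lt with h | h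
    · rw [← h, show -1 - η = -(1 + η) by ring, hwm]
    · rcases hy.2.eq_or_lt with h' | h'
      · rw [h', hwp]
      · exact (hwpos y ⟨h, h'⟩).le
  obtain ⟨a, hya, haη⟩ := exists_between (show |p₀.2| < 1 + η by
    have := hΩsub hp₀
    rw [abs_lt]
    exact ⟨by linarith [this.1], this.2⟩)
  have ha : 0 < a := (abs_nonneg _).trans_lt hya
  have haIoo : Icc (-a) a ⊆ Ioo (-1 - η) (1 + η) := fun y hy =>
    ⟨by linarith [hy.1], by linarith [hy.2]⟩
  obtain ⟨y₁, hy₁, hmin⟩ := isCompact_Icc.exists_isMinOn (nonempty_Icc.2 (by linarith : -a ≤ a))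
    (hwC.continuousOn.mono (haIoo.trans Ioo_subset_Icc_self))
  have hc₀ : 0 < w y₁ := hwpos y₁ (haIoo hy₁)
  obtain ⟨K, ψ, ψ', ψ'', hK, hψC, hψ', hψ'', hψ0, hψpos, hψz, hψK⟩ := exists_bump_deriv_ge ha
  let j : Fin N := ⟨0, hN⟩
  let α : ℝ := √(lam * C + K + 1)
  have hα : α ^ 2 = lam * C + K + 1 := Real.sq_sqrt (by positivity)
  let φ : Pt N → ℝ := fun q => Real.exp (α * q.1 j) * ψ q.2
  have hφC : ContDiff ℝ 2 φ := by
    have hψ2 : ContDiff ℝ 2 fun q : Pt N => ψ q.2 := hψC.comp contDiff_snd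
    have hX : ContDiff ℝ 2 fun q : Pt N => q.1 j := (contDiff_apply ℝ ℝ j).comp contDiff_fst
    exact (contDiff_const.mul hX).exp.mul hψ2
  have hφ0 : ∀ p, 0 ≤ φ p := fun p => mul_nonneg (Real.exp_nonneg _) (hψ0 _)
  have hlapφ : ∀ p, (lam * C + 1) * φ p ≤ lap φ p := by
    intro p
    have hE : ∀ x, HasDerivAt (fun x => Real.exp (α * x)) (α * Real.exp (α * x)) x := fun x => by
      simpa [mul_comm] using ((hasDerivAt_id x).const_mul α).exp
    have h : lap φ p = _ := lap_mul_coord (p := p) j hE ((hE (p.1 j)).const_mul α)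
      (Eventually.of_forall hψ') (hψ'' p.2)
    rw [h]
    have h1 := mul_le_mul_of_nonneg_left (hψK p.2) (Real.exp_nonneg (α * p.1 j))
    have h2 : α * (α * Real.exp (α * p.1 j)) * ψ p.2 = (lam * C + K + 1) * φ p := by
      rw [← hα]
      ring
    have h3 : Real.exp (α * p.1 j) * -(K * ψ p.2) = -(K * φ p) := by ring
    linarith
  obtain ⟨Φ, hΦ⟩ := hcpt.exists_bound_of_continuousOn hφC.continuous.continuousOn
  have hΦ0 : 0 ≤ Φ := (norm_nonneg _).trans (hΦ p₀ (subset_closure hp₀))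
  let t : ℝ := w y₁ / (Φ + 1)
  have ht : 0 < t := by positivity
  have htφ : ∀ p ∈ closure Ω, t * φ p ≤ w p.2 := by
    intro p hp
    rcases le_or_gt a |p.2| with h | h
    · simpa [φ, hψz _ h] using hw0 _ (hstrip p hp)
    · refine le_trans ?_ (hmin (show p.2 ∈ Icc (-a) a from abs_le.1 h.le))
      simp only [t]
      rw [div_mul_eq_mul_div, div_le_iff₀ (by positivity)]
      have := (le_abs_self _).trans (hΦ p hp)
      exact mul_le_mul_of_nonneg_left (by linarith) hc₀.le
  let W : Pt N → ℝ := fun q => w q.2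
  have hwat : ∀ p ∈ Ω, ContDiffAt ℝ 2 w p.2 := fun p hp =>
    hwC.contDiffAt (Icc_mem_nhds (hΩsub hp).1 (hΩsub hp).2)
  have hWat : ∀ p ∈ Ω, ContDiffAt ℝ 2 W p := fun p hp => (hwat p hp).comp p contDiffAt_snd
  have huat : ∀ p ∈ Ω, ContDiffAt ℝ 2 u p := fun p hp =>
    huC.contDiffAt (mem_of_superset (hΩopen.mem_nhds hp) subset_closure)
  have hlapW : ∀ p ∈ Ω, lap W p = deriv (deriv w) p.2 := by
    intro p hp
    have hIoo := isOpen_Ioo.mem_nhds (hΩsub hp)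
    have hd : ∀ᶠ y in 𝓝 p.2, HasDerivAt w (deriv w y) y := by
      filter_upwards [(hwat p hp).eventually (by simp)] with y hy
      exact (hy.differentiableAt (by norm_num)).hasDerivAt
    have hdd : HasDerivAt (deriv w) (deriv (deriv w) p.2) p.2 :=
      ((((hwC.mono Ioo_subset_Icc_self).deriv_of_isOpen (m := 1) isOpen_Ioo
        (by norm_num)).contDiffAt hIoo).differentiableAt one_ne_zero).hasDerivAt
    have := lap_mul_coord (A := fun _ => 1) (A' := fun _ => 0) (A'' := 0) j
      (fun x => hasDerivAt_const x 1) (hasDerivAt_const _ 0) hd hdd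
    simpa [W] using this
  let v : Pt N → ℝ := fun q => (u q + (-1) * W q) + t * φ q
  have hz : ∀ p ∈ Ω, ContDiffAt ℝ 2 (fun q => u q + (-1) * W q) p := fun p hp =>
    (huat p hp).add (contDiffAt_const.mul (hWat p hp))
  have hlapv : ∀ p ∈ Ω, lap v p = lap u p + (-1) * lap W p + t * lap φ p := fun p hp => by
    rw [← lap_add_const_mul (huat p hp) (hWat p hp), ← lap_add_const_mul (hz p hp) hφC.contDiffAt]
  have hWc : ContinuousOn W (closure Ω) :=
    hwC.continuousOn.comp continuous_snd.continuousOn hstrip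
  have hvp₀ := nonpos_of_stable_of_subsolution hΩopen hΩbd hV hstab (v := v)
    (ρ := fun p => t * φ p)
    (fun p hp => ((hz p hp).add (contDiffAt_const.mul hφC.contDiffAt)).contDiffWithinAt)
    ((huc.add (continuousOn_const.mul hWc)).add
      (continuousOn_const.mul hφC.continuous.continuousOn))
    (fun p hp => by
      have h1 := htφ p (frontier_subset_closure hp)
      have h2 := hub p hp
      simp only [v, W, h2]
      linarith)
    (continuousOn_const.mul hφC.continuous.continuousOn)
    (fun p _ => mul_nonneg ht.le (hφ0 p))
    (fun p hp => by
      rw [hlapv p hp, hueq p hp, hlapW p hp]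
      have h1 := hweq p.2 (hΩsub hp)
      have h2 := mul_le_mul_of_nonneg_left
        (hconv.sub_le_deriv_mul_sub (hf.differentiable one_ne_zero) (u p) (w p.2)) hlam.le
      have h3 := mul_le_mul_of_nonneg_left (hlapφ p) ht.le
      have h4 : -C ≤ V p := (abs_le.1 (hC p (subset_closure hp))).1
      have h5 := mul_le_mul_of_nonneg_left h4
        (mul_nonneg hlam.le (mul_nonneg ht.le (hφ0 p)))
      simp only [v, V, W] at h5 ⊢
      linarith)
    hp₀ (mul_pos ht (mul_pos (Real.exp_pos _) (hψpos _ hya)))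
  have := mul_nonneg ht.le (hφ0 p₀)
  simp only [v, W] at hvp₀
  linarith
end
end
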